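/- arXiv:math/0403190 — 2 statements merged into one kernel-verified Lean document; each statement's English description precedes it below -/
import Mathlib

section
/- Let α ∈ (0,1) be irrational with bounded continued fraction coefficients (equivalently, α is badly approximable: there exists c > 0 with ‖qα‖ ≥ c/q for all q ∈ ℕ, where ‖x‖ denotes the distance from x to the nearest integer). Then the circle map subshift Ω_{α,β} satisfies Boshernitzan's condition (B) for every β ∈ (0,1). -/
open Filter MeasureTheory Set

noncomputable section

/-- `SL(2,ℝ)`. -/
abbrev SL2 : Type := Matrix.SpecialLinearGroup (Fin 2) ℝ

/-- The left shift on two-sided sequences. -/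
def shift (𝒜 : Type*) : (ℤ → 𝒜) → ℤ → 𝒜 := fun ω n => ω (n + 1)

/-- A subshift: a closed, shift-invariant set of two-sided sequences. -/
def IsSubshift {𝒜 : Type*} [TopologicalSpace 𝒜] (Ω : Set (ℤ → 𝒜)) : Prop :=
  IsClosed Ω ∧ shift 𝒜 '' Ω = Ω

/-- A minimal subshift: every two-sided orbit is dense. -/
def IsMinimalSubshift {𝒜 : Type*} [TopologicalSpace 𝒜] (Ω : Set (ℤ → 𝒜)) : Prop :=
  IsSubshift Ω ∧ ∀ ω ∈ Ω, Ω ⊆ closure (Set.range fun k : ℤ => fun n : ℤ => ω (n + k))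

/-- An aperiodic subshift: no nontrivial shift fixes a point of `Ω`. -/
def IsAperiodicSubshift {𝒜 : Type*} (Ω : Set (ℤ → 𝒜)) : Prop :=
  ∀ ω ∈ Ω, ∀ n : ℤ, n ≠ 0 → (fun m => ω (m + n)) ≠ ω

/-- The word `w` occurs in `ω` starting at position `k`. -/
def OccursAt {𝒜 : Type*} (ω : ℤ → 𝒜) (w : List 𝒜) (k : ℤ) : Prop :=
  ∀ i : Fin w.length, ω (k + i) = w.get i

/-- `w` belongs to `𝒲(Ω)`, the set of finite words of the subshift `Ω`. -/
def IsWordOf {𝒜 : Type*} (Ω : Set (ℤ → 𝒜)) (w : List 𝒜) : Prop :=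
  ∃ ω ∈ Ω, ∃ k : ℤ, OccursAt ω w k

/-- `V_w = {ω ∈ Ω : ω(1)⋯ω(|w|) = w}`. -/
def Vset {𝒜 : Type*} (Ω : Set (ℤ → 𝒜)) (w : List 𝒜) : Set (ℤ → 𝒜) :=
  {ω ∈ Ω | OccursAt ω w 1}

/-- `U_w = {ω ∈ Ω : w occurs in ω around position one}`. -/
def Uset {𝒜 : Type*} (Ω : Set (ℤ → 𝒜)) (w : List 𝒜) : Set (ℤ → 𝒜) :=
  {ω ∈ Ω | ∃ n : ℕ, n < w.length ∧ OccursAt ω w (1 - n)}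

/-- Boshernitzan's condition (B): there are an ergodic probability measure `ν` (concentrated
on `Ω`), a constant `C > 0` and lengths `l n → ∞` with `|w| ν(V_w) ≥ C` whenever `|w| = l n`;
equivalently `limsup n η_ν(n) > 0`. -/
def CondB {𝒜 : Type*} [MeasurableSpace 𝒜] (Ω : Set (ℤ → 𝒜)) : Prop :=
  ∃ ν : Measure (ℤ → 𝒜), IsProbabilityMeasure ν ∧ ν Ωᶜ = 0 ∧ Ergodic (shift 𝒜) ν ∧
    ∃ C > (0 : ℝ), ∃ l : ℕ → ℕ, Tendsto l atTop atTop ∧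
      ∀ n : ℕ, ∀ w : List 𝒜, IsWordOf Ω w → w.length = l n →
        C ≤ (w.length : ℝ) * (ν (Vset Ω w)).toReal

/-- Condition (B'): there are an ergodic probability measure `ν` (concentrated on `Ω`),
a constant `C' > 0` and lengths `l n → ∞` with `ν(U_w) ≥ C'` whenever `|w| = l n`. -/
def CondB' {𝒜 : Type*} [MeasurableSpace 𝒜] (Ω : Set (ℤ → 𝒜)) : Prop :=
  ∃ ν : Measure (ℤ → 𝒜), IsProbabilityMeasure ν ∧ ν Ωᶜ = 0 ∧ Ergodic (shift 𝒜) ν ∧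
    ∃ C > (0 : ℝ), ∃ l : ℕ → ℕ, Tendsto l atTop atTop ∧
      ∀ n : ℕ, ∀ w : List 𝒜, IsWordOf Ω w → w.length = l n →
        C ≤ (ν (Uset Ω w)).toReal

/-- Unique ergodicity: there is exactly one shift-invariant Borel probability measure
concentrated on `Ω`. -/
def UniquelyErgodicSubshift {𝒜 : Type*} [MeasurableSpace 𝒜] (Ω : Set (ℤ → 𝒜)) : Prop :=
  ∃! ν : Measure (ℤ → 𝒜),
    IsProbabilityMeasure ν ∧ ν Ωᶜ = 0 ∧ MeasurePreserving (shift 𝒜) ν ν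

/-- A function on sequences is locally constant (on `Ω`) if its value only depends on
the coordinates `ω(−N)⋯ω(N)` for some `N`. -/
def LocConstOn {𝒜 β : Type*} (Ω : Set (ℤ → 𝒜)) (A : (ℤ → 𝒜) → β) : Prop :=
  ∃ N : ℕ, ∀ ω ∈ Ω, ∀ ρ ∈ Ω, (∀ i : ℤ, |i| ≤ (N : ℤ) → ω i = ρ i) → A ω = A ρ

/-- The cocycle `A(n,ω) = A(T^{n−1}ω)⋯A(ω)`. -/
def cocycle {𝒜 G : Type*} [Monoid G] (A : (ℤ → 𝒜) → G) : ℕ → (ℤ → 𝒜) → G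
  | 0, _ => 1
  | n + 1, ω => A ((shift 𝒜)^[n] ω) * cocycle A n ω

/-- A concrete norm on 2×2 real matrices (the Frobenius norm). -/
def matNorm (M : Matrix (Fin 2) (Fin 2) ℝ) : ℝ :=
  Real.sqrt (∑ i : Fin 2, ∑ j : Fin 2, (M i j) ^ 2)

/-- `A : Ω → SL(2,ℝ)` is uniform: `(1/n) log‖A(n,ω)‖` converges, uniformly on `Ω`,
to a constant `Λ(A)`. -/
def IsUniformOn {𝒜 : Type*} (Ω : Set (ℤ → 𝒜)) (A : (ℤ → 𝒜) → SL2) : Prop :=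
  ∃ Λ : ℝ, TendstoUniformlyOn
    (fun (n : ℕ) (ω : ℤ → 𝒜) =>
      (n : ℝ)⁻¹ * Real.log (matNorm ((cocycle A n ω : SL2) : Matrix (Fin 2) (Fin 2) ℝ)))
    (fun _ => Λ) atTop Ω

/-- Property (P): every locally constant `SL(2,ℝ)`-valued function on `Ω` is uniform. -/
def PropP {𝒜 : Type*} (Ω : Set (ℤ → 𝒜)) : Prop :=
  ∀ A : (ℤ → 𝒜) → SL2, LocConstOn Ω A → IsUniformOn Ω A

/-- The word `ω(1)⋯ω(n)`. -/
def wordOf {𝒜 : Type*} (ω : ℤ → 𝒜) (n : ℕ) : List 𝒜 :=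
  (List.range n).map fun i => ω (1 + i)

/-- A subadditive function on the words of `Ω`. -/
def SubadditiveOn {𝒜 : Type*} (Ω : Set (ℤ → 𝒜)) (F : List 𝒜 → ℝ) : Prop :=
  ∀ x y : List 𝒜, IsWordOf Ω x → IsWordOf Ω y → IsWordOf Ω (x ++ y) →
    F (x ++ y) ≤ F x + F y

/-- The complexity function `p(n) = #{w ∈ 𝒲(Ω) : |w| = n}`. -/
def complexity {𝒜 : Type*} (Ω : Set (ℤ → 𝒜)) (n : ℕ) : ℕ :=
  Set.ncard {w : List 𝒜 | IsWordOf Ω w ∧ w.length = n}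

/-- A right-special word. -/
def RightSpecial {𝒜 : Type*} (Ω : Set (ℤ → 𝒜)) (w : List 𝒜) : Prop :=
  ∃ a b : 𝒜, a ≠ b ∧ IsWordOf Ω (w ++ [a]) ∧ IsWordOf Ω (w ++ [b])

/-- A left-special word. -/
def LeftSpecial {𝒜 : Type*} (Ω : Set (ℤ → 𝒜)) (w : List 𝒜) : Prop :=
  ∃ a b : 𝒜, a ≠ b ∧ IsWordOf Ω (a :: w) ∧ IsWordOf Ω (b :: w)

/-- `σ ∈ ℬ^ℤ` is the image of `ω ∈ 𝒜^ℤ` under the substitution `S`, with `S(ω(0))`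
starting at position `0`. -/
def IsSubstImage {𝒜 ℬ : Type*} (S : 𝒜 → List ℬ) (ω : ℤ → 𝒜) (σ : ℤ → ℬ) : Prop :=
  ∃ c : ℤ → ℤ, c 0 = 0 ∧ (∀ k : ℤ, c (k + 1) = c k + (S (ω k)).length) ∧
    ∀ k : ℤ, ∀ j : Fin (S (ω k)).length, σ (c k + j) = (S (ω k)).get j

/-- `Ω(S) = {T^k S(ω) : ω ∈ Ω, k ∈ ℤ}`. -/
def SubstSubshift {𝒜 ℬ : Type*} (S : 𝒜 → List ℬ) (Ω : Set (ℤ → 𝒜)) : Set (ℤ → ℬ) :=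
  {τ | ∃ ω ∈ Ω, ∃ σ : ℤ → ℬ, IsSubstImage S ω σ ∧ ∃ k : ℤ, τ = fun n => σ (n + k)}

/-- `S` is recognizable with respect to `(Ω,T)`: there is a locally constant
`S̃ : Ω(S) → Ω × ℤ` with `S̃(T^k S(ω)) = (ω,k)` for `0 ≤ k ≤ |S(ω(0))|`. -/
def Recognizable {𝒜 ℬ : Type*} (S : 𝒜 → List ℬ) (Ω : Set (ℤ → 𝒜)) : Prop :=
  ∃ St : (ℤ → ℬ) → (ℤ → 𝒜) × ℤ, LocConstOn (SubstSubshift S Ω) St ∧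
    ∀ ω ∈ Ω, ∀ σ : ℤ → ℬ, IsSubstImage S ω σ →
      ∀ k : ℕ, k ≤ (S (ω 0)).length → St (fun n => σ (n + k)) = (ω, (k : ℤ))

/-- A Cantor set: compact, empty interior, no isolated points. -/
def IsCantorSet (S : Set ℝ) : Prop :=
  IsCompact S ∧ interior S = ∅ ∧ ∀ x ∈ S, AccPt x (Filter.principal S)

/-- `H` is the Schrödinger operator on `ℓ²(ℤ)` with potential `V`:
`(Hu)(n) = u(n+1) + u(n−1) + V(n)u(n)`. -/
def IsSchrodingerOp (V : ℤ → ℝ)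
    (H : lp (fun _ : ℤ => ℝ) 2 →L[ℝ] lp (fun _ : ℤ => ℝ) 2) : Prop :=
  ∀ u : lp (fun _ : ℤ => ℝ) 2, ∀ n : ℤ,
    (H u : ∀ _ : ℤ, ℝ) n = (u : ∀ _ : ℤ, ℝ) (n + 1) + (u : ∀ _ : ℤ, ℝ) (n - 1)
      + V n * (u : ∀ _ : ℤ, ℝ) n

/-- The circle map potential `V_{α,β,θ}(n) = χ_{[1−β,1)}(nα + θ mod 1)`. -/
def circleV (α β θ : ℝ) : ℤ → ℝ := fun n =>
  (Set.Ico (1 - β) 1).indicator (fun _ => (1 : ℝ)) (Int.fract (n * α + θ))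

/-- The coding `v_n(α,β,θ) = χ_{[0,β)}(nα + θ mod 1)` of the rotation by `α`. -/
def circleSeq (α β θ : ℝ) : ℤ → Bool := fun n =>
  if Int.fract (n * α + θ) < β then true else false

/-- The circle map subshift `Ω_{α,β}`. -/
def circleSubshift (α β : ℝ) : Set (ℤ → Bool) :=
  closure {ω | ∃ θ : ℝ, 0 ≤ θ ∧ θ < 1 ∧ ω = circleSeq α β θ}

/-- The one-step transfer matrix `M^E(ω)`. -/
def transferMat (E : ℝ) (ω : ℤ → ℝ) : Matrix (Fin 2) (Fin 2) ℝ :=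
  !![E - ω 1, -1; 1, 0]

/-- The Lyapunov exponent `γ(E) = inf_{n ≥ 1} (1/n) ∫ log‖M^E(n,ω)‖ dμ(ω)`. -/
def lyapunov (μ : Measure (ℤ → ℝ)) (E : ℝ) : ℝ :=
  ⨅ n : ℕ+, ((n : ℕ) : ℝ)⁻¹ *
    ∫ ω, Real.log (matNorm (cocycle (transferMat E) (n : ℕ) ω)) ∂μ

end

/-- A two-sided orbit of the rotation by `α`, coded by whether it visits `[0,β)`. -/
noncomputable def circleCode (α β : ℝ) (x : UnitAddCircle) : ℤ → Bool := fun n =>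
  if ((AddCircle.equivIco (1 : ℝ) 0 (x + n • (α : UnitAddCircle)) : ℝ)) < β then true else false

theorem circleCode_coe (α β θ : ℝ) : circleCode α β (θ : UnitAddCircle) = circleSeq α β θ := by
  funext n
  have h : ((θ : UnitAddCircle) + n • (α : UnitAddCircle)) = ((n * α + θ : ℝ) : UnitAddCircle) := by
    rw [add_comm, ← AddCircle.coe_zsmul, zsmul_eq_mul, AddCircle.coe_add]
  simp only [circleCode, circleSeq, h]
  have := AddCircle.coe_equivIco_mk_apply (p := (1 : ℝ)) (n * α + θ)
  rw [div_one, mul_one] at this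
  rw [← this]

theorem measurable_circleCode (α β : ℝ) : Measurable (circleCode α β) := by
  refine measurable_pi_lambda _ fun n => ?_
  have h : Measurable fun x : UnitAddCircle =>
      ((AddCircle.measurableEquivIco (1 : ℝ) 0 (x + n • (α : UnitAddCircle)) : ℝ)) :=
    measurable_subtype_coe.comp ((AddCircle.measurableEquivIco (1 : ℝ) 0).measurable.comp
      (measurable_id.add_const _))
  exact Measurable.ite (measurableSet_lt h measurable_const) measurable_const measurable_const

theorem circleSeq_fract (α β θ : ℝ) : circleSeq α β (Int.fract θ) = circleSeq α β θ := by
  rw [← circleCode_coe, ← circleCode_coe]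
  congr 1
  rw [← sub_eq_zero, ← AddCircle.coe_sub, AddCircle.coe_eq_zero_iff]
  exact ⟨-⌊θ⌋, by rw [← Int.self_sub_floor]; simp⟩

theorem circleSeq_mem_circleSubshift (α β θ : ℝ) : circleSeq α β θ ∈ circleSubshift α β :=
  subset_closure ⟨Int.fract θ, Int.fract_nonneg _, Int.fract_lt_one _, (circleSeq_fract α β θ).symm⟩

theorem circleSeq_add (α β θ : ℝ) (k n : ℤ) :
    circleSeq α β θ (k + n) = circleSeq α β (θ + k * α) n := by
  simp only [circleSeq]
  rw [show ((k + n : ℤ) : ℝ) * α + θ = n * α + (θ + k * α) by push_cast; ring]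

theorem ergodic_shift_map_circleCode {α : ℝ} (hirr : Irrational α) (β : ℝ) :
    Ergodic (shift Bool) ((volume : Measure UnitAddCircle).map (circleCode α β)) := by
  have hrot : Ergodic (fun x : UnitAddCircle => x + (α : UnitAddCircle)) := by
    rw [AddCircle.ergodic_add_right, addOrderOf_eq_zero_iff, isOfFinAddOrder_iff_nsmul_eq_zero]
    rintro ⟨n, hn, h⟩
    rw [← AddCircle.coe_nsmul, AddCircle.coe_eq_zero_iff] at h
    obtain ⟨m, hm⟩ := h
    simp only [zsmul_eq_mul, mul_one, nsmul_eq_mul] at hm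
    exact (hirr.natCast_mul hn.ne').ne_int m hm.symm
  refine MeasurePreserving.ergodic_of_ergodic_semiconj
    ⟨measurable_circleCode α β, rfl⟩ hrot ?_ ?_
  · exact measurable_pi_lambda _ fun n => measurable_pi_apply _
  · intro x
    funext n
    simp only [circleCode, shift]
    rw [show x + (α : UnitAddCircle) + n • (α : UnitAddCircle) =
      x + (n + 1) • (α : UnitAddCircle) by rw [add_zsmul, one_zsmul]; abel]

theorem isOpen_occursAt {𝒜 : Type*} [TopologicalSpace 𝒜] [DiscreteTopology 𝒜] (w : List 𝒜)
    (k : ℤ) : IsOpen {ω : ℤ → 𝒜 | OccursAt ω w k} := by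
  simp only [OccursAt, ofPred_forall]
  exact isOpen_iInter_of_finite fun i =>
    (isOpen_discrete ({w.get i} : Set 𝒜)).preimage
      (continuous_apply (A := fun _ : ℤ => 𝒜) (k + (i : ℤ)))

/-- Every word of the circle map subshift is read off some coded orbit at position one. -/
theorem exists_occursAt_circleSeq {α β : ℝ} {w : List Bool}
    (hw : IsWordOf (circleSubshift α β) w) : ∃ θ : ℝ, OccursAt (circleSeq α β θ) w 1 := by
  obtain ⟨ω, hω, k, hk⟩ := hw
  obtain ⟨_, hocc, θ, -, -, rfl⟩ := mem_closure_iff.1 hω _ (isOpen_occursAt w k) hk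
  refine ⟨θ + (k - 1 : ℤ) * α, fun i => ?_⟩
  rw [← circleSeq_add, ← hocc i]
  congr 1
  ring

/-- If the coding changes between `a` and `b`, then `(a, b]` contains an endpoint of `[0,β) + ℤ`. -/
theorem exists_endpoint_of_ne {β a b : ℝ} (hab : a ≤ b)
    (h : ¬ (Int.fract a < β ↔ Int.fract b < β)) :
    ∃ m : ℤ, (a < m ∧ (m : ℝ) ≤ b) ∨ (a < m + β ∧ m + β ≤ b) := by
  by_contra! hc
  have h1 : ⌊a⌋ = ⌊b⌋ := by
    refine le_antisymm (Int.floor_mono hab) (Int.le_floor.2 ?_)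
    by_contra! h'
    exact absurd (Int.floor_le b) (not_le.2 ((hc ⌊b⌋).1 h'))
  have h2 : ⌊a - β⌋ = ⌊b - β⌋ := by
    refine le_antisymm (Int.floor_mono (by linarith)) (Int.le_floor.2 ?_)
    by_contra! h'
    have := (hc ⌊b - β⌋).2 (by linarith)
    linarith [Int.floor_le (b - β)]
  have key : ∀ t : ℝ, Int.fract t < β ↔ ⌊t - β⌋ < ⌊t⌋ := fun t => by
    rw [Int.floor_lt, Int.fract]
    constructor <;> intro <;> linarith
  exact h (by rw [key, key, h1, h2])

theorem exists_endpoint_of_circleSeq_ne {α β θ s : ℝ} (hs : 0 ≤ s) {n : ℤ}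
    (h : circleSeq α β (θ + s) n ≠ circleSeq α β θ n) :
    ∃ (m : ℤ) (b : ℤ), (b = 0 ∨ b = 1) ∧ n * α + θ < m + b * β ∧
      m + b * β ≤ n * α + (θ + s) := by
  have := exists_endpoint_of_ne (β := β) (a := n * α + θ) (b := n * α + (θ + s)) (by linarith)
    (fun hiff => h (by simp only [circleSeq, hiff]))
  obtain ⟨m, ⟨h1, h2⟩ | ⟨h1, h2⟩⟩ := this
  · exact ⟨m, 0, Or.inl rfl, by simpa using h1, by simpa using h2⟩
  · exact ⟨m, 1, Or.inr rfl, by simpa using h1, by simpa using h2⟩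

theorem badlyApproximable_int {α c : ℝ}
    (hc : ∀ q : ℕ, 0 < q → c / (q : ℝ) ≤ |(q : ℝ) * α - (round ((q : ℝ) * α) : ℝ)|)
    {q : ℤ} (hq : q ≠ 0) (m : ℤ) : c ≤ |(q : ℝ)| * |(q : ℝ) * α - m| := by
  have hpos : (0 : ℝ) < |(q : ℝ)| := abs_pos.2 (by exact_mod_cast hq)
  have hcast : ((q.natAbs : ℕ) : ℝ) = |(q : ℝ)| := by rw [Nat.cast_natAbs]; push_cast; rfl
  have h := hc q.natAbs (Int.natAbs_pos.2 hq)
  rw [hcast, div_le_iff₀' hpos] at h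
  refine h.trans (mul_le_mul_of_nonneg_left ?_ hpos.le)
  rcases le_or_gt 0 (q : ℝ) with h0 | h0
  · rw [abs_of_nonneg h0]
    exact round_le _ _
  · rw [abs_of_neg h0]
    refine (round_le _ (-m)).trans (le_of_eq ?_)
    rw [← abs_neg]
    congr 1
    push_cast
    ring

/-- Arbitrarily large scales `N` at which no small multiple of `α` approximates `β` well. -/
theorem exists_scale {α c : ℝ} (hc1 : c ≤ 1)
    (hc : ∀ q : ℤ, q ≠ 0 → ∀ m : ℤ, c ≤ |(q : ℝ)| * |(q : ℝ) * α - m|) (β : ℝ) (N₀ : ℕ) :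
    ∃ N : ℕ, N₀ ≤ N ∧ 0 < N ∧ ∀ j m : ℤ, |j| ≤ N → (j : ℝ) * α - β - m ≠ 0 →
      c / 6 ≤ N * |(j : ℝ) * α - β - m| := by
  by_contra! H
  have H' : ∀ i : ℕ, ∃ p : ℤ × ℤ, |p.1| ≤ ((N₀ + 1 + i : ℕ) : ℤ) ∧
      (p.1 : ℝ) * α - β - p.2 ≠ 0 ∧
      ((N₀ + 1 + i : ℕ) : ℝ) * |(p.1 : ℝ) * α - β - p.2| < c / 6 := fun i => by
    obtain ⟨j, m, h⟩ := H (N₀ + 1 + i) (by omega) (by omega)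
    exact ⟨(j, m), h⟩
  choose p hp1 hp2 hp3 using H'
  have hstep : ∀ i, p (i + 1) = p i := by
    intro i
    set N : ℝ := ((N₀ + 1 + i : ℕ) : ℝ) with hN
    have hN1 : (1 : ℝ) ≤ N := by rw [hN]; exact_mod_cast (by omega : 1 ≤ N₀ + 1 + i)
    have hN' : ((N₀ + 1 + (i + 1) : ℕ) : ℝ) = N + 1 := by rw [hN]; push_cast; ring
    set x : ℝ := ((p i).1 : ℝ) * α - β - (p i).2 with hx
    set y : ℝ := ((p (i + 1)).1 : ℝ) * α - β - (p (i + 1)).2 with hy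
    have h3 : N * |x| < c / 6 := hp3 i
    have h4 : N * |y| < c / 6 := by
      have := hp3 (i + 1)
      rw [hN'] at this
      nlinarith [abs_nonneg y]
    have hxy : N * |y - x| < c / 3 := by
      have := mul_le_mul_of_nonneg_left (abs_sub y x) (by linarith : 0 ≤ N)
      linarith
    have hq : (p (i + 1)).1 = (p i).1 := by
      by_contra hne
      have hb := hc ((p (i + 1)).1 - (p i).1) (sub_ne_zero.2 hne) ((p (i + 1)).2 - (p i).2)
      have e : (((p (i + 1)).1 - (p i).1 : ℤ) : ℝ) * α - (((p (i + 1)).2 - (p i).2 : ℤ) : ℝ)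
          = y - x := by
        rw [hx, hy]; push_cast; ring
      rw [e] at hb
      have hd : |(((p (i + 1)).1 - (p i).1 : ℤ) : ℝ)| ≤ 3 * N := by
        have a1 : |((p i).1 : ℝ)| ≤ N := by rw [hN]; exact_mod_cast hp1 i
        have a2 : |((p (i + 1)).1 : ℝ)| ≤ N + 1 := by rw [← hN']; exact_mod_cast hp1 (i + 1)
        have a3 := abs_sub ((p (i + 1)).1 : ℝ) ((p i).1 : ℝ)
        push_cast
        linarith
      have := mul_le_mul_of_nonneg_right hd (abs_nonneg (y - x))
      linarith
    have hm : (p (i + 1)).2 = (p i).2 := by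
      have e : y - x = (((p i).2 - (p (i + 1)).2 : ℤ) : ℝ) := by
        rw [hx, hy, hq]; push_cast; ring
      have hlt : |y - x| < 1 := by nlinarith [abs_nonneg (y - x)]
      rw [e, ← Int.cast_abs] at hlt
      have : |(p i).2 - (p (i + 1)).2| < 1 := by exact_mod_cast hlt
      have := Int.abs_lt_one_iff.1 this
      omega
    exact Prod.ext hq hm
  have hconst : ∀ i, p i = p 0 := fun i => by
    induction i with
    | zero => rfl
    | succ i ih => rw [hstep, ih]
  have hpos := abs_pos.2 (hp2 0)
  obtain ⟨i, hi⟩ := exists_nat_gt (c / 6 / |((p 0).1 : ℝ) * α - β - (p 0).2|)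
  rw [div_lt_iff₀ hpos] at hi
  have h := hp3 i
  rw [hconst i] at h
  push_cast at h
  nlinarith

/-- At a scale `N` with well separated endpoints, the word of length `N` read at `θ` persists on one
side of `θ`. -/
theorem circleSeq_const_right_or_left {α β c : ℝ} (hc0 : 0 < c) (hc1 : c ≤ 1)
    (hc : ∀ q : ℤ, q ≠ 0 → ∀ m : ℤ, c ≤ |(q : ℝ)| * |(q : ℝ) * α - m|)
    {N : ℕ} (hN : 0 < N) (hsep : ∀ j m : ℤ, |j| ≤ N → (j : ℝ) * α - β - m ≠ 0 →
      c / 6 ≤ N * |(j : ℝ) * α - β - m|) {r : ℝ} (hr : N * r = c / 12) (θ : ℝ) :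
    (∀ s, 0 < s → s < r → ∀ n : ℤ, 1 ≤ n → n ≤ N →
      circleSeq α β (θ + s) n = circleSeq α β θ n) ∨
    (∀ s, 0 < s → s < r → ∀ n : ℤ, 1 ≤ n → n ≤ N →
      circleSeq α β (θ - s) n = circleSeq α β θ n) := by
  by_contra! H
  obtain ⟨⟨s, hs0, hsr, n, hn1, hnN, hne⟩, ⟨t, ht0, htr, k, hk1, hkN, hne'⟩⟩ := H
  obtain ⟨m, b, hb, h1, h2⟩ := exists_endpoint_of_circleSeq_ne hs0.le hne
  obtain ⟨m', b', hb', h3, h4⟩ := exists_endpoint_of_circleSeq_ne (θ := θ - t) (s := t) ht0.le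
    (by rw [sub_add_cancel]; exact hne'.symm)
  have hNR : (1 : ℝ) ≤ N := by exact_mod_cast hN
  set d : ℝ := (m + b * β) - (m' + b' * β) - (n - k) * α with hd
  have hd0 : 0 < d := by rw [hd]; linarith
  have hd2 : d < 2 * r := by rw [hd]; linarith
  have hNd : N * d < c / 6 := by nlinarith
  have hd1 : d < 1 := by nlinarith
  have hnk : |n - k| ≤ (N : ℤ) := abs_le.2 ⟨by omega, by omega⟩
  have hsame : d ≠ m - m' - (n - k) * α := fun e => by
    have e' : d = |((n - k : ℤ) : ℝ) * α - ((m - m' : ℤ) : ℝ)| := by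
      rw [abs_sub_comm, ← abs_of_pos hd0, e]
      push_cast
      rfl
    have hq : n - k ≠ 0 := fun h0 => by
      rw [h0, Int.cast_zero, zero_mul, zero_sub, abs_neg, ← Int.cast_abs] at e'
      rw [e'] at hd0 hd1
      have h5 : 0 < |m - m'| := by exact_mod_cast hd0
      have h6 : |m - m'| < 1 := by exact_mod_cast hd1
      omega
    have h5 := hc (n - k) hq (m - m')
    have h6 : |((n - k : ℤ) : ℝ)| ≤ N := by exact_mod_cast hnk
    rw [← e'] at h5
    have := mul_le_mul_of_nonneg_right h6 hd0.le
    linarith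
  have hdiff : ∀ j M : ℤ, |j| ≤ N → |(j : ℝ) * α - β - M| ≠ d := fun j M hj e => by
    have h5 := hsep j M hj (abs_pos.1 (e ▸ hd0))
    rw [e] at h5
    linarith
  rcases hb with rfl | rfl <;> rcases hb' with rfl | rfl
  · exact hsame (by rw [hd]; push_cast; ring)
  · refine hdiff (k - n) (m' - m) (by rwa [abs_sub_comm]) ?_
    rw [← abs_of_pos hd0, hd]
    congr 1
    push_cast
    ring
  · refine hdiff (n - k) (m - m') hnk ?_
    rw [← abs_of_pos hd0, hd, ← abs_neg]
    congr 1
    push_cast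
    ring
  · exact hsame (by rw [hd]; push_cast; ring)

theorem isProbabilityMeasure_map_circleCode (α β : ℝ) :
    IsProbabilityMeasure ((volume : Measure UnitAddCircle).map (circleCode α β)) := by
  have : IsProbabilityMeasure (volume : Measure UnitAddCircle) :=
    ⟨UnitAddCircle.measure_univ⟩
  exact Measure.isProbabilityMeasure_map (measurable_circleCode α β).aemeasurable

theorem ofReal_le_volume_of_Ioo {S : Set UnitAddCircle} {a r : ℝ} (hr : r ≤ 1)
    (h : ∀ t ∈ Ioo a (a + r), (t : UnitAddCircle) ∈ S) : ENNReal.ofReal r ≤ volume S := by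
  have hmp := UnitAddCircle.measurePreserving_mk a
  calc ENNReal.ofReal r = volume (Ioo a (a + r)) := by rw [Real.volume_Ioo, add_sub_cancel_left]
    _ = (volume.restrict (Ioc a (a + 1))) (Ioo a (a + r)) := by
      rw [Measure.restrict_eq_self]
      exact fun x hx => ⟨hx.1, by linarith [hx.2]⟩
    _ ≤ (volume.restrict (Ioc a (a + 1))) ((fun x : ℝ => (x : UnitAddCircle)) ⁻¹' S) :=
      measure_mono h
    _ ≤ volume S := by
      rw [← hmp.map_eq]
      exact Measure.le_map_apply hmp.measurable.aemeasurable S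

/-- for badly approximable irrational `α`, the circle map subshift
`Ω_{α,β}` satisfies (B) for every `β`. -/
theorem stmt17 (α : ℝ) (hα : α ∈ Set.Ioo (0 : ℝ) 1) (hirr : Irrational α)
    (hba : ∃ c > (0 : ℝ), ∀ q : ℕ, 0 < q →
      c / (q : ℝ) ≤ |(q : ℝ) * α - (round ((q : ℝ) * α) : ℝ)|) :
    ∀ β ∈ Set.Ioo (0 : ℝ) 1, CondB (circleSubshift α β) := by
  intro β _
  obtain ⟨c, hc0, hba⟩ := hba
  have hc : ∀ q : ℤ, q ≠ 0 → ∀ m : ℤ, c ≤ |(q : ℝ)| * |(q : ℝ) * α - m| :=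
    fun q hq m => badlyApproximable_int hba hq m
  have hc1 : c ≤ 1 := by
    have := hc 1 one_ne_zero 0
    simp only [Int.cast_one, abs_one, one_mul, Int.cast_zero, sub_zero, abs_of_pos hα.1] at this
    linarith [hα.2]
  have hmeas := measurable_circleCode α β
  have hmem : ∀ x, circleCode α β x ∈ circleSubshift α β := fun x => by
    obtain ⟨θ, rfl⟩ := QuotientAddGroup.mk_surjective x
    exact circleCode_coe α β θ ▸ circleSeq_mem_circleSubshift α β θ
  refine ⟨(volume : Measure UnitAddCircle).map (circleCode α β),
    isProbabilityMeasure_map_circleCode α β, ?_,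
    ergodic_shift_map_circleCode hirr β, c / 12, by positivity, ?_⟩
  · have hclosed : IsClosed (circleSubshift α β) := isClosed_closure
    rw [Measure.map_apply hmeas hclosed.measurableSet.compl]
    convert measure_empty (μ := (volume : Measure UnitAddCircle))
    exact eq_empty_of_forall_notMem fun x hx => hx (hmem x)
  choose l hl0 hl1 hl2 using exists_scale hc1 hc β
  refine ⟨l, tendsto_atTop_mono hl0 tendsto_id, fun i w hw hlen => ?_⟩
  have := isProbabilityMeasure_map_circleCode α β
  obtain ⟨θ, hθ⟩ := exists_occursAt_circleSeq hw
  have hN1 : (1 : ℝ) ≤ l i := by exact_mod_cast hl1 i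
  set r : ℝ := c / 12 / l i with hr
  have hNr : (l i : ℝ) * r = c / 12 := by rw [hr]; field_simp
  have hr1 : r ≤ 1 := by nlinarith
  have hocc : ∀ θ', (∀ n : ℤ, 1 ≤ n → n ≤ l i → circleSeq α β θ' n = circleSeq α β θ n) →
      (θ' : UnitAddCircle) ∈ circleCode α β ⁻¹' Vset (circleSubshift α β) w := fun θ' h => by
    refine ⟨hmem _, fun j => ?_⟩
    rw [circleCode_coe, h _ (by omega) (by have := j.2; omega), hθ j]
  have hvol : ENNReal.ofReal r ≤
      (volume : Measure UnitAddCircle).map (circleCode α β) (Vset (circleSubshift α β) w) := by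
    refine le_trans ?_ (Measure.le_map_apply hmeas.aemeasurable _)
    rcases circleSeq_const_right_or_left hc0 hc1 hc (hl1 i) (hl2 i) hNr θ with h | h
    · refine ofReal_le_volume_of_Ioo (a := θ) hr1 fun t ht => hocc t ?_
      have := h (t - θ) (by linarith [ht.1]) (by linarith [ht.2])
      rwa [add_sub_cancel] at this
    · refine ofReal_le_volume_of_Ioo (a := θ - r) hr1 fun t ht => hocc t ?_
      have := h (θ - t) (by linarith [ht.2]) (by linarith [ht.1])
      rwa [sub_sub_cancel] at this
  rw [hlen, ← hNr]
  exact mul_le_mul_of_nonneg_left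
    ((ENNReal.ofReal_le_iff_le_toReal (measure_ne_top _ _)).1 hvol) (by positivity)
end

section
/- For every m ≥ 3 there exists an Arnoux-Rauzy subshift over the alphabet 𝒜_m = {1,…,m} that does not satisfy Boshernitzan's condition (B). -/
open Filter MeasureTheory Set

/-- An Arnoux-Rauzy subshift over `Fin m`: minimal, with exactly one right-special and
one left-special word of each length, each having all `m` one-letter extensions. -/
def IsArnouxRauzy (m : ℕ) (Ω : Set (ℤ → Fin m)) : Prop :=
  IsMinimalSubshift Ω ∧
  (∀ n : ℕ, ∃! w : List (Fin m), IsWordOf Ω w ∧ w.length = n ∧ RightSpecial Ω w) ∧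
  (∀ n : ℕ, ∃! w : List (Fin m), IsWordOf Ω w ∧ w.length = n ∧ LeftSpecial Ω w) ∧
  (∀ w : List (Fin m), IsWordOf Ω w → RightSpecial Ω w →
    ∀ a : Fin m, IsWordOf Ω (w ++ [a])) ∧
  (∀ w : List (Fin m), IsWordOf Ω w → LeftSpecial Ω w →
    ∀ a : Fin m, IsWordOf Ω (a :: w))


namespace ArnouxRauzy

section Words

variable {α : Type*} [DecidableEq α]

/-- The Arnoux-Rauzy substitution `i ↦ i`, `c ↦ i c` for `c ≠ i`. -/
def arSubst (i : α) (x : List α) : List α :=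
  x.flatMap fun c => if c = i then [i] else [i, c]

@[simp] lemma arSubst_nil (i : α) : arSubst i [] = [] := rfl

lemma arSubst_cons_self (i : α) (x : List α) : arSubst i (i :: x) = i :: arSubst i x := by
  simp [arSubst]

lemma arSubst_cons_ne {i c : α} (h : c ≠ i) (x : List α) :
    arSubst i (c :: x) = i :: c :: arSubst i x := by
  simp [arSubst, h]

@[simp] lemma arSubst_append (i : α) (x y : List α) :
    arSubst i (x ++ y) = arSubst i x ++ arSubst i y := by
  simp [arSubst]

lemma length_le_arSubst (i : α) (x : List α) : x.length ≤ (arSubst i x).length := by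
  induction x with
  | nil => simp
  | cons c x ih =>
    by_cases h : c = i
    · subst h; simp [arSubst_cons_self, ih]
    · simp [arSubst_cons_ne h]; omega

lemma arSubst_length_le (i : α) (x : List α) : (arSubst i x).length ≤ 2 * x.length := by
  induction x with
  | nil => simp
  | cons c x ih =>
    by_cases h : c = i
    · subst h; simp [arSubst_cons_self]; omega
    · simp [arSubst_cons_ne h]; omega

lemma exists_arSubst_cons (i c : α) (x : List α) : ∃ r, arSubst i (c :: x) = i :: r := by
  by_cases h : c = i
  · subst h; exact ⟨_, arSubst_cons_self _ _⟩
  · exact ⟨_, arSubst_cons_ne h _⟩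

lemma exists_arSubst_concat (i c : α) (x : List α) :
    ∃ r, arSubst i (x ++ [c]) = r ++ [c] := by
  by_cases h : c = i
  · subst h; exact ⟨arSubst c x, by simp [arSubst_cons_self]⟩
  · exact ⟨arSubst i x ++ [i], by simp [arSubst_cons_ne h]⟩

lemma exists_arSubst_append_singleton (i : α) (x : List α) :
    ∃ r, arSubst i x ++ [i] = i :: r := by
  cases x with
  | nil => exact ⟨[], rfl⟩
  | cons c x => obtain ⟨r, hr⟩ := exists_arSubst_cons i c x; exact ⟨r ++ [i], by simp [hr]⟩

lemma arSubst_injective (i : α) : Function.Injective (arSubst i) := by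
  intro x
  induction x with
  | nil =>
    intro y h
    have := length_le_arSubst i y
    rw [← h] at this
    exact (List.length_eq_zero_iff.1 (by simpa using this)).symm
  | cons c x ih =>
    intro y h
    cases y with
    | nil => obtain ⟨r, hr⟩ := exists_arSubst_cons i c x; simp [hr] at h
    | cons e y =>
      by_cases hc : c = i <;> by_cases he : e = i
      · subst hc; subst he
        simp only [arSubst_cons_self, List.cons.injEq, true_and] at h
        rw [ih h]
      · subst hc
        simp only [arSubst_cons_self, arSubst_cons_ne he, List.cons.injEq, true_and] at h
        cases x with
        | nil => simp at h
        | cons f x =>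
          obtain ⟨r, hr⟩ := exists_arSubst_cons c f x
          rw [hr] at h
          exact absurd (List.cons.inj h).1.symm he
      · subst he
        simp only [arSubst_cons_self, arSubst_cons_ne hc, List.cons.injEq, true_and] at h
        cases y with
        | nil => simp at h
        | cons f y =>
          obtain ⟨r, hr⟩ := exists_arSubst_cons e f y
          rw [hr] at h
          exact absurd (List.cons.inj h).1 hc
      · simp only [arSubst_cons_ne hc, arSubst_cons_ne he, List.cons.injEq, true_and] at h
        rw [h.1, ih h.2]

/-- Every occurrence of `i` in an image under `arSubst i` starts the image of a letter. -/
lemma arSubst_split {i : α} {x p r : List α} (h : arSubst i x = p ++ i :: r) :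
    ∃ y z, x = y ++ z ∧ arSubst i y = p ∧ arSubst i z = i :: r := by
  induction x generalizing p with
  | nil => simp at h
  | cons c x ih =>
    cases p with
    | nil => exact ⟨[], c :: x, rfl, rfl, h⟩
    | cons e p =>
      by_cases hc : c = i
      · subst hc
        rw [arSubst_cons_self] at h
        simp only [List.cons_append, List.cons.injEq] at h
        obtain ⟨y, z, rfl, hy, hz⟩ := ih h.2
        exact ⟨c :: y, z, rfl, by rw [arSubst_cons_self, hy, h.1], hz⟩
      · rw [arSubst_cons_ne hc] at h
        simp only [List.cons_append, List.cons.injEq] at h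
        cases p with
        | nil =>
          simp only [List.nil_append, List.cons.injEq] at h
          exact absurd h.2.1 hc
        | cons f p =>
          simp only [List.cons_append, List.cons.injEq] at h
          obtain ⟨y, z, rfl, hy, hz⟩ := ih h.2.2
          exact ⟨c :: y, z, rfl, by rw [arSubst_cons_ne hc, hy, h.1, h.2.1], hz⟩

lemma arSubst_split_mid {i : α} {x p v q : List α}
    (h : arSubst i x = p ++ (arSubst i v ++ [i]) ++ q) :
    ∃ y z, x = y ++ (v ++ z) ∧ arSubst i y = p ∧ arSubst i z = i :: q := by
  obtain ⟨r, hr⟩ := exists_arSubst_append_singleton i v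
  obtain ⟨y, z₁, rfl, hy, hz₁⟩ := arSubst_split (i := i) (p := p) (r := r ++ q) (x := x)
    (by rw [h, hr]; simp)
  obtain ⟨v', z, rfl, hv, hz⟩ := arSubst_split (i := i) (p := arSubst i v) (r := q) (x := z₁)
    (by rw [hz₁, ← List.cons_append, ← hr]; simp)
  rw [arSubst_injective i hv]
  exact ⟨y, z, rfl, hy, hz⟩

lemma head_eq_of_arSubst_eq {i c : α} {z q : List α} (h : arSubst i z = i :: c :: q) :
    ∃ z', z = c :: z' := by
  cases z with
  | nil => simp at h
  | cons e z =>
    by_cases he : e = i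
    · subst he
      rw [arSubst_cons_self] at h
      cases z with
      | nil => simp at h
      | cons f z =>
        obtain ⟨r, hr⟩ := exists_arSubst_cons e f z
        rw [hr] at h
        simp only [List.cons.injEq, true_and] at h
        exact ⟨f :: z, by rw [h.1]⟩
    · rw [arSubst_cons_ne he] at h
      simp only [List.cons.injEq, true_and] at h
      exact ⟨z, by rw [h.1]⟩

lemma last_eq_of_arSubst_eq {i c : α} {z q : List α} (h : arSubst i z = q ++ [c]) :
    ∃ z', z = z' ++ [c] := by
  rcases List.eq_nil_or_concat z with rfl | ⟨z', e, rfl⟩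
  · simp at h
  · obtain ⟨r, hr⟩ := exists_arSubst_concat i e z'
    rw [List.concat_eq_append, hr] at h
    have := List.append_inj_right' h rfl
    exact ⟨z', by simpa using this⟩

/-- Of two neighbouring letters in an image under `arSubst i`, one is `i`. -/
lemma eq_or_eq_of_arSubst {i c e : α} {x p q : List α}
    (h : arSubst i x = p ++ c :: e :: q) : c = i ∨ e = i := by
  induction x generalizing p with
  | nil => simp at h
  | cons f x ih =>
    by_cases hf : f = i
    · subst hf
      rw [arSubst_cons_self] at h
      cases p with
      | nil => left; simp at h; exact h.1.symm
      | cons g p => simp only [List.cons_append, List.cons.injEq] at h; exact ih h.2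
    · rw [arSubst_cons_ne hf] at h
      rcases p with _ | ⟨g, _ | ⟨g', p⟩⟩
      · left; simp at h; exact h.1.symm
      · right
        simp only [List.cons_append, List.nil_append, List.cons.injEq] at h
        cases x with
        | nil => simp at h
        | cons f' x =>
          obtain ⟨r, hr⟩ := exists_arSubst_cons i f' x
          rw [hr] at h
          simp at h
          exact h.2.2.1.symm
      · simp only [List.cons_append, List.cons.injEq] at h; exact ih h.2.2

/-- The image of the letter `a` under the substitutions directed by `d k, …, d (k + n - 1)`. -/
def arWord (d : ℕ → α) : ℕ → ℕ → α → List α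
  | _, 0, a => [a]
  | k, n + 1, a => arSubst (d k) (arWord d (k + 1) n a)

/-- The language directed by the sequence `d k, d (k + 1), …`. -/
def Lang (d : ℕ → α) (k : ℕ) (u : List α) : Prop := ∃ n a, u <:+: arWord d k n a

variable {d : ℕ → α} {k : ℕ}

lemma Lang.infix {u v : List α} (h : Lang d k v) (huv : u <:+: v) : Lang d k u := by
  obtain ⟨n, a, h⟩ := h
  exact ⟨n, a, huv.trans h⟩

lemma lang_singleton (d : ℕ → α) (k : ℕ) (a : α) : Lang d k [a] := ⟨0, a, List.infix_rfl⟩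

lemma Lang.map {x : List α} (h : Lang d (k + 1) x) : Lang d k (arSubst (d k) x) := by
  obtain ⟨n, a, p, q, h⟩ := h
  refine ⟨n + 1, a, arSubst (d k) p, arSubst (d k) q, ?_⟩
  rw [arWord, ← h]
  simp

lemma Lang.exists_map {u : List α} (h : Lang d k u) :
    ∃ x p q, Lang d (k + 1) x ∧ arSubst (d k) x = p ++ u ++ q := by
  obtain ⟨n, a, h⟩ := h
  cases n with
  | zero =>
    have h1 : [a] <:+: arSubst (d k) [a] := by
      obtain ⟨r, hr⟩ := exists_arSubst_concat (d k) a []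
      exact ⟨r, [], by simpa using hr.symm⟩
    obtain ⟨p, q, hpq⟩ := List.IsInfix.trans h h1
    exact ⟨[a], p, q, lang_singleton _ _ _, hpq.symm⟩
  | succ n =>
    obtain ⟨p, q, h⟩ := h
    exact ⟨arWord d (k + 1) n a, p, q, ⟨n, a, List.infix_rfl⟩, h.symm⟩

lemma Lang.eq_or_eq {c e : α} (h : Lang d k [c, e]) : c = d k ∨ e = d k := by
  obtain ⟨x, p, q, -, h⟩ := h.exists_map
  exact eq_or_eq_of_arSubst (p := p) (q := q) (by rw [h]; simp)

/-- Each letter occurs infinitely often in the directive sequence. -/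
def Recurrent (d : ℕ → α) : Prop := ∀ a N, ∃ n, N ≤ n ∧ d n = a

lemma exists_lang_pair_right [Nontrivial α] (hd : Recurrent d) (k : ℕ) (a : α) :
    ∃ b, Lang d k [a, b] := by
  obtain ⟨n, hn, ha⟩ := hd a k
  obtain ⟨b, hb⟩ := exists_ne a
  induction hn using Nat.decreasingInduction with
  | self =>
    refine ⟨b, 1, b, ?_⟩
    rw [arWord, arWord, ha, arSubst_cons_ne hb]
    exact List.infix_rfl
  | of_succ j hj ih =>
    obtain ⟨e, he⟩ := ih
    refine ⟨d j, he.map.infix ?_⟩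
    obtain ⟨r, hr⟩ := exists_arSubst_concat (d j) a []
    obtain ⟨s, hs⟩ := exists_arSubst_cons (d j) e []
    refine ⟨r, s, ?_⟩
    rw [show [a, e] = ([] ++ [a]) ++ [e] from rfl, arSubst_append, hr, hs]
    simp

lemma exists_lang_pair_left [Nontrivial α] (hd : Recurrent d) (k : ℕ) (a : α) :
    ∃ b, Lang d k [b, a] := by
  obtain ⟨b, hb⟩ := exists_ne a
  obtain ⟨n, hn, hdn⟩ := hd b k
  induction hn using Nat.decreasingInduction with
  | self =>
    refine ⟨b, 1, a, ?_⟩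
    rw [arWord, arWord, hdn, arSubst_cons_ne hb.symm]
    exact List.infix_rfl
  | of_succ j hj ih =>
    obtain ⟨e, he⟩ := ih
    by_cases haj : a = d j
    · refine ⟨e, he.map.infix ?_⟩
      obtain ⟨r, hr⟩ := exists_arSubst_concat (d j) e []
      refine ⟨r, [], ?_⟩
      rw [show [e, a] = ([] ++ [e]) ++ [a] from rfl, arSubst_append, hr, haj, arSubst_cons_self]
      simp
    · exact ⟨d j, he.map.infix
        ⟨arSubst (d j) [e], [], by
          rw [show [e, a] = [e] ++ [a] from rfl, arSubst_append, arSubst_cons_ne haj]; simp⟩⟩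

lemma Lang.exists_concat [Nontrivial α] (hd : Recurrent d) {u : List α} (h : Lang d k u) :
    ∃ b, Lang d k (u ++ [b]) := by
  obtain ⟨n, a, h⟩ := h
  suffices H : ∃ b, Lang d k (arWord d k n a ++ [b]) by
    obtain ⟨p, q, h⟩ := h
    obtain ⟨b, hb⟩ := H
    cases q with
    | nil => exact ⟨b, hb.infix ⟨p, [], by rw [← h]; simp⟩⟩
    | cons c q => exact ⟨c, hb.infix ⟨p, q ++ [b], by rw [← h]; simp⟩⟩
  clear h
  induction n generalizing k with
  | zero => exact exists_lang_pair_right hd k a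
  | succ n ih =>
    obtain ⟨b, hb⟩ := ih (k := k + 1)
    obtain ⟨r, hr⟩ := exists_arSubst_cons (d k) b []
    exact ⟨d k, hb.map.infix ⟨[], r, by simp [arWord, hr]⟩⟩

lemma Lang.exists_cons [Nontrivial α] (hd : Recurrent d) {u : List α} (h : Lang d k u) :
    ∃ b, Lang d k (b :: u) := by
  obtain ⟨n, a, h⟩ := h
  suffices H : ∃ b, Lang d k (b :: arWord d k n a) by
    obtain ⟨p, q, h⟩ := h
    obtain ⟨b, hb⟩ := H
    rcases List.eq_nil_or_concat p with rfl | ⟨p, c, rfl⟩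
    · exact ⟨b, hb.infix ⟨[], q, by rw [← h]; simp⟩⟩
    · exact ⟨c, hb.infix ⟨b :: p, q, by rw [← h]; simp⟩⟩
  clear h
  induction n generalizing k with
  | zero => exact exists_lang_pair_left hd k a
  | succ n ih =>
    obtain ⟨b, hb⟩ := ih (k := k + 1)
    obtain ⟨r, hr⟩ := exists_arSubst_concat (d k) b []
    refine ⟨b, hb.map.infix ⟨r, [], ?_⟩⟩
    have : b :: arWord d (k + 1) n a = ([] ++ [b]) ++ arWord d (k + 1) n a := rfl
    rw [this, arSubst_append, hr]
    simp [arWord]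

/-- A word of the language beginning and ending with `d k` can be desubstituted. -/
lemma Lang.exists_eq_map {w u : List α} (h : Lang d k (w ++ [d k]))
    (hu : w ++ [d k] = d k :: u) : ∃ v, w = arSubst (d k) v := by
  obtain ⟨x, p, q, -, h⟩ := h.exists_map
  obtain ⟨y, z, rfl, -, hz⟩ := arSubst_split (p := p) (r := u ++ q) (by rw [h, hu]; simp)
  obtain ⟨v, z, rfl, hv, -⟩ := arSubst_split (x := z) (p := w) (r := q)
    (by rw [hz, ← List.cons_append, ← hu]; simp)
  exact ⟨v, hv.symm⟩

lemma length_lt_of_cons_eq {i c : α} {u v : List α} (hc : c ≠ i)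
    (h : i :: c :: u = arSubst i v ++ [i]) : v.length < (c :: u).length := by
  cases v with
  | nil => simp at h
  | cons e v =>
    have := length_le_arSubst i v
    by_cases he : e = i
    · subst he
      rw [arSubst_cons_self] at h
      obtain ⟨r, hr⟩ := exists_arSubst_append_singleton e v
      rw [List.cons_append, hr] at h
      simp at h
      exact absurd h.1 hc
    · rw [arSubst_cons_ne he] at h
      have := congrArg List.length h
      simp at this ⊢
      omega

lemma length_lt_of_concat_eq {i c : α} {u v : List α} (hc : c ≠ i)
    (h : u ++ [c] ++ [i] = arSubst i v ++ [i]) : v.length < (u ++ [c]).length := by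
  have h := List.append_inj_left' h rfl
  obtain ⟨v, rfl⟩ := last_eq_of_arSubst_eq h.symm
  have := length_le_arSubst i v
  have := congrArg List.length h
  rw [arSubst_append, arSubst_cons_ne hc] at this
  simp at this ⊢
  omega

section Special

variable [Nontrivial α]

lemma lang_map_concat_iff (hd : Recurrent d) {v : List α} {c : α} :
    Lang d k (arSubst (d k) v ++ [d k] ++ [c]) ↔ Lang d (k + 1) (v ++ [c]) := by
  constructor
  · intro h
    obtain ⟨x, p, q, hx, h⟩ := h.exists_map
    obtain ⟨y, z, rfl, -, hz⟩ := arSubst_split_mid (p := p) (v := v) (q := c :: q)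
      (by rw [h]; simp)
    obtain ⟨z, rfl⟩ := head_eq_of_arSubst_eq hz
    exact hx.infix ⟨y, z, by simp⟩
  · intro h
    obtain ⟨e, he⟩ := h.exists_concat hd
    obtain ⟨r, hr⟩ := exists_arSubst_cons (d k) e []
    by_cases hc : c = d k
    · refine he.map.infix ⟨[], r, ?_⟩
      rw [arSubst_append, hr, arSubst_append, hc, arSubst_cons_self]
      simp
    · refine he.map.infix ⟨[], d k :: r, ?_⟩
      rw [arSubst_append, hr, arSubst_append, arSubst_cons_ne hc]
      simp

lemma lang_cons_map_iff (hd : Recurrent d) {v : List α} {c : α} :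
    Lang d k (c :: (arSubst (d k) v ++ [d k])) ↔ Lang d (k + 1) (c :: v) := by
  constructor
  · intro h
    obtain ⟨x, p, q, hx, h⟩ := h.exists_map
    obtain ⟨y, z, rfl, hy, hz⟩ := arSubst_split_mid (p := p ++ [c]) (v := v) (q := q)
      (by rw [h]; simp)
    obtain ⟨y, rfl⟩ := last_eq_of_arSubst_eq hy
    exact hx.infix ⟨y, z, by simp⟩
  · intro h
    obtain ⟨e, he⟩ := h.exists_concat hd
    obtain ⟨r, hr⟩ := exists_arSubst_cons (d k) e []
    obtain ⟨s, hs⟩ := exists_arSubst_concat (d k) c []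
    refine he.map.infix ⟨s, r, ?_⟩
    rw [show c :: v ++ [e] = ([] ++ [c]) ++ v ++ [e] by simp, arSubst_append, arSubst_append, hr,
      hs]
    simp

lemma lang_map_iff (hd : Recurrent d) {v : List α} :
    Lang d k (arSubst (d k) v ++ [d k]) ↔ Lang d (k + 1) v := by
  constructor
  · intro h
    obtain ⟨c, h⟩ := h.exists_concat hd
    exact ((lang_map_concat_iff hd).1 h).infix ⟨[], [c], rfl⟩
  · intro h
    obtain ⟨c, h⟩ := h.exists_concat hd
    exact ((lang_map_concat_iff hd).2 h).infix ⟨[], [c], rfl⟩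

/-- The word `w` can be followed by two different letters. -/
def RSpecial (d : ℕ → α) (k : ℕ) (w : List α) : Prop :=
  ∃ a b, a ≠ b ∧ Lang d k (w ++ [a]) ∧ Lang d k (w ++ [b])

/-- The word `w` can be preceded by two different letters. -/
def LSpecial (d : ℕ → α) (k : ℕ) (w : List α) : Prop :=
  ∃ a b, a ≠ b ∧ Lang d k (a :: w) ∧ Lang d k (b :: w)

lemma RSpecial.desubst (hd : Recurrent d) {w : List α} (hw : w ≠ []) (h : RSpecial d k w) :
    ∃ v, w <:+ arSubst (d k) v ++ [d k] ∧ v.length < w.length ∧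
      ∀ a, Lang d k (w ++ [a]) ↔ Lang d (k + 1) (v ++ [a]) := by
  obtain ⟨a, b, hab, ha, hb⟩ := h
  obtain ⟨w, e, rfl⟩ := (List.eq_nil_or_concat w).resolve_left hw
  rw [List.concat_eq_append] at *
  have he : e = d k := by
    by_contra he
    have h1 := (ha.infix (u := [e, a]) ⟨w, [], by simp⟩).eq_or_eq.resolve_left he
    have h2 := (hb.infix (u := [e, b]) ⟨w, [], by simp⟩).eq_or_eq.resolve_left he
    exact hab (h1.trans h2.symm)
  subst he
  obtain ⟨c, u, hu⟩ := List.exists_cons_of_ne_nil hw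
  have hl : Lang d k (w ++ [d k]) := ha.infix ⟨[], [a], by simp⟩
  by_cases hc : c = d k
  · subst hc
    obtain ⟨v, rfl⟩ := hl.exists_eq_map hu
    refine ⟨v, List.suffix_rfl, ?_, fun a => lang_map_concat_iff hd⟩
    have := length_le_arSubst (d k) v
    simp
    omega
  · have key : ∀ t, Lang d k (w ++ [d k] ++ t) → Lang d k (d k :: w ++ [d k] ++ t) := by
      intro t ht
      obtain ⟨e, he⟩ := ht.exists_cons hd
      have := (he.infix (u := [e, c]) ⟨[], u ++ t, by rw [hu]; simp⟩).eq_or_eq.resolve_right hc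
      subst this
      simpa using he
    obtain ⟨v, hv⟩ := Lang.exists_eq_map (w := d k :: w) (u := w ++ [d k])
      (by simpa using key [] (by simpa using hl)) rfl
    refine ⟨v, ⟨[d k], by simp [← hv]⟩, ?_, fun a => ?_⟩
    · rw [hu]
      exact length_lt_of_cons_eq hc (by rw [← hu, ← hv]; rfl)
    · rw [← lang_map_concat_iff hd, ← hv]
      exact ⟨key [a], fun h => h.infix ⟨[d k], [], by simp⟩⟩

lemma LSpecial.desubst (hd : Recurrent d) {w : List α} (hw : w ≠ []) (h : LSpecial d k w) :
    ∃ v, w <+: arSubst (d k) v ++ [d k] ∧ v.length < w.length ∧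
      ∀ a, Lang d k (a :: w) ↔ Lang d (k + 1) (a :: v) := by
  obtain ⟨a, b, hab, ha, hb⟩ := h
  obtain ⟨e, w, rfl⟩ := List.exists_cons_of_ne_nil hw
  have he : e = d k := by
    by_contra he
    have h1 := (ha.infix (u := [a, e]) ⟨[], w, by simp⟩).eq_or_eq.resolve_right he
    have h2 := (hb.infix (u := [b, e]) ⟨[], w, by simp⟩).eq_or_eq.resolve_right he
    exact hab (h1.trans h2.symm)
  subst he
  obtain ⟨u, c, hu⟩ := (List.eq_nil_or_concat (d k :: w)).resolve_left hw
  rw [List.concat_eq_append] at hu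
  have hl : Lang d k (d k :: w) := ha.infix ⟨[a], [], by simp⟩
  by_cases hc : c = d k
  · subst hc
    rw [hu] at hl
    obtain ⟨v, rfl⟩ := hl.exists_eq_map hu.symm
    refine ⟨v, by rw [hu], ?_, fun a => by rw [hu]; exact lang_cons_map_iff hd⟩
    have := length_le_arSubst (d k) v
    simp [hu]
    omega
  · have key : ∀ t, Lang d k (t ++ d k :: w) → Lang d k (t ++ (d k :: w ++ [d k])) := by
      intro t ht
      obtain ⟨e, he⟩ := ht.exists_concat hd
      have := (he.infix (u := [c, e]) ⟨t ++ u, [], by rw [hu]; simp⟩).eq_or_eq.resolve_left hc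
      subst this
      simpa using he
    obtain ⟨v, hv⟩ := Lang.exists_eq_map (w := d k :: w) (u := w ++ [d k])
      (by simpa using key [] (by simpa using hl)) rfl
    refine ⟨v, ⟨[d k], by simp [← hv]⟩, ?_, fun a => ?_⟩
    · rw [hu]
      exact length_lt_of_concat_eq hc (by rw [← hu, ← hv])
    · rw [← lang_cons_map_iff hd, ← hv]
      exact ⟨key [a], fun h => h.infix ⟨[], [d k], by simp⟩⟩

lemma RSpecial.lang_concat (hd : Recurrent d) {w : List α} (h : RSpecial d k w) (a : α) :
    Lang d k (w ++ [a]) := by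
  induction hn : w.length using Nat.strong_induction_on generalizing k w with
  | _ n ih =>
    by_cases hw : w = []
    · subst hw; exact lang_singleton d k a
    · obtain ⟨v, -, hlt, hv⟩ := h.desubst hd hw
      obtain ⟨a', b', hab, ha, hb⟩ := h
      exact (hv a).2 (ih _ (hn ▸ hlt) ⟨a', b', hab, (hv _).1 ha, (hv _).1 hb⟩ rfl)

lemma LSpecial.lang_cons (hd : Recurrent d) {w : List α} (h : LSpecial d k w) (a : α) :
    Lang d k (a :: w) := by
  induction hn : w.length using Nat.strong_induction_on generalizing k w with
  | _ n ih =>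
    by_cases hw : w = []
    · subst hw; exact lang_singleton d k a
    · obtain ⟨v, -, hlt, hv⟩ := h.desubst hd hw
      obtain ⟨a', b', hab, ha, hb⟩ := h
      exact (hv a).2 (ih _ (hn ▸ hlt) ⟨a', b', hab, (hv _).1 ha, (hv _).1 hb⟩ rfl)

lemma RSpecial.suffix_or_suffix (hd : Recurrent d) {u w : List α} (hu : RSpecial d k u)
    (hw : RSpecial d k w) : u <:+ w ∨ w <:+ u := by
  induction hn : u.length using Nat.strong_induction_on generalizing k u w with
  | _ n ih =>
    by_cases hu0 : u = []
    · exact .inl (hu0 ▸ List.nil_suffix)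
    by_cases hw0 : w = []
    · exact .inr (hw0 ▸ List.nil_suffix)
    obtain ⟨x, hux, hlt, hx⟩ := hu.desubst hd hu0
    obtain ⟨y, hwy, -, hy⟩ := hw.desubst hd hw0
    have hxs : RSpecial d (k + 1) x := by
      obtain ⟨a, b, hab, ha, hb⟩ := hu; exact ⟨a, b, hab, (hx _).1 ha, (hx _).1 hb⟩
    have hys : RSpecial d (k + 1) y := by
      obtain ⟨a, b, hab, ha, hb⟩ := hw; exact ⟨a, b, hab, (hy _).1 ha, (hy _).1 hb⟩
    have key : ∀ {p q : List α}, p <:+ q →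
        arSubst (d k) p ++ [d k] <:+ arSubst (d k) q ++ [d k] := by
      rintro p _ ⟨r, rfl⟩
      exact ⟨arSubst (d k) r, by simp⟩
    rcases ih _ (hn ▸ hlt) hxs hys rfl with h | h
    · exact List.suffix_or_suffix_of_suffix (hux.trans (key h)) hwy
    · exact List.suffix_or_suffix_of_suffix hux (hwy.trans (key h))

lemma LSpecial.prefix_or_prefix (hd : Recurrent d) {u w : List α} (hu : LSpecial d k u)
    (hw : LSpecial d k w) : u <+: w ∨ w <+: u := by
  induction hn : u.length using Nat.strong_induction_on generalizing k u w with
  | _ n ih =>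
    by_cases hu0 : u = []
    · exact .inl (hu0 ▸ List.nil_prefix)
    by_cases hw0 : w = []
    · exact .inr (hw0 ▸ List.nil_prefix)
    obtain ⟨x, hux, hlt, hx⟩ := hu.desubst hd hu0
    obtain ⟨y, hwy, -, hy⟩ := hw.desubst hd hw0
    have hxs : LSpecial d (k + 1) x := by
      obtain ⟨a, b, hab, ha, hb⟩ := hu; exact ⟨a, b, hab, (hx _).1 ha, (hx _).1 hb⟩
    have hys : LSpecial d (k + 1) y := by
      obtain ⟨a, b, hab, ha, hb⟩ := hw; exact ⟨a, b, hab, (hy _).1 ha, (hy _).1 hb⟩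
    have key : ∀ {p q : List α}, p <+: q →
        arSubst (d k) p ++ [d k] <+: arSubst (d k) q ++ [d k] := by
      rintro p _ ⟨r, rfl⟩
      obtain ⟨s, hs⟩ := exists_arSubst_append_singleton (d k) r
      exact ⟨s, by rw [arSubst_append, List.append_assoc _ _ [d k], hs]; simp⟩
    rcases ih _ (hn ▸ hlt) hxs hys rfl with h | h
    · exact List.prefix_or_prefix_of_prefix (hux.trans (key h)) hwy
    · exact List.prefix_or_prefix_of_prefix hux (hwy.trans (key h))

lemma existsUnique_rSpecial (hd : Recurrent d) (k n : ℕ) :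
    ∃! w, w.length = n ∧ RSpecial d k w := by
  refine existsUnique_of_exists_of_unique ?_ ?_
  · suffices H : ∃ w, n ≤ w.length ∧ RSpecial d k w by
      obtain ⟨w, hn, a, b, hab, ha, hb⟩ := H
      refine ⟨w.drop (w.length - n), by simp; omega, a, b, hab, ?_, ?_⟩
      · exact ha.infix ⟨w.take (w.length - n), [], by simp [← List.append_assoc]⟩
      · exact hb.infix ⟨w.take (w.length - n), [], by simp [← List.append_assoc]⟩
    induction n generalizing k with
    | zero =>
      obtain ⟨a, b, hab⟩ := exists_pair_ne α
      exact ⟨[], le_rfl, a, b, hab, lang_singleton d k a, lang_singleton d k b⟩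
    | succ n ih =>
      obtain ⟨v, hn, a, b, hab, ha, hb⟩ := ih (k + 1)
      refine ⟨arSubst (d k) v ++ [d k], ?_, a, b, hab, (lang_map_concat_iff hd).2 ha,
        (lang_map_concat_iff hd).2 hb⟩
      have := length_le_arSubst (d k) v
      simp
      omega
  · rintro u w ⟨hul, hu⟩ ⟨hwl, hw⟩
    rcases hu.suffix_or_suffix hd hw with h | h
    · exact h.eq_of_length (hul.trans hwl.symm)
    · exact (h.eq_of_length (hwl.trans hul.symm)).symm

lemma existsUnique_lSpecial (hd : Recurrent d) (k n : ℕ) :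
    ∃! w, w.length = n ∧ LSpecial d k w := by
  refine existsUnique_of_exists_of_unique ?_ ?_
  · suffices H : ∃ w, n ≤ w.length ∧ LSpecial d k w by
      obtain ⟨w, hn, a, b, hab, ha, hb⟩ := H
      refine ⟨w.take n, by simp; omega, a, b, hab, ?_, ?_⟩
      · exact ha.infix ⟨[], w.drop n, by simp⟩
      · exact hb.infix ⟨[], w.drop n, by simp⟩
    induction n generalizing k with
    | zero =>
      obtain ⟨a, b, hab⟩ := exists_pair_ne α
      exact ⟨[], le_rfl, a, b, hab, lang_singleton d k a, lang_singleton d k b⟩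
    | succ n ih =>
      obtain ⟨v, hn, a, b, hab, ha, hb⟩ := ih (k + 1)
      refine ⟨arSubst (d k) v ++ [d k], ?_, a, b, hab, (lang_cons_map_iff hd).2 ha,
        (lang_cons_map_iff hd).2 hb⟩
      have := length_le_arSubst (d k) v
      simp
      omega
  · rintro u w ⟨hul, hu⟩ ⟨hwl, hw⟩
    rcases hu.prefix_or_prefix hd hw with h | h
    · exact h.eq_of_length (hul.trans hwl.symm)
    · exact (h.eq_of_length (hwl.trans hul.symm)).symm

end Special

section Recurrence

/-- `u` occurs in all sufficiently long words of the language. -/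
def UnifRec (d : ℕ → α) (k : ℕ) (u : List α) : Prop :=
  ∃ R, ∀ w, Lang d k w → R ≤ w.length → u <:+: w

lemma Lang.exists_map_infix [Nontrivial α] (hd : Recurrent d) {w : List α} {R : ℕ}
    (h : Lang d k w) (hR : 2 * R + 3 ≤ w.length) :
    ∃ y, Lang d (k + 1) y ∧ R ≤ y.length ∧ arSubst (d k) y <:+: w := by
  obtain ⟨c₁, c₂, w₁, rfl⟩ : ∃ c₁ c₂ w₁, w = c₁ :: c₂ :: w₁ := by
    rcases w with _ | ⟨c₁, _ | ⟨c₂, w₁⟩⟩ <;> simp at hR ⊢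
  obtain ⟨p, r, hp, hpr⟩ : ∃ p r, p.length ≤ 1 ∧ c₁ :: c₂ :: w₁ = p ++ d k :: r := by
    rcases (h.infix (u := [c₁, c₂]) ⟨[], w₁, rfl⟩).eq_or_eq with rfl | rfl
    · exact ⟨[], c₂ :: w₁, by simp, rfl⟩
    · exact ⟨[c₁], w₁, by simp, rfl⟩
  obtain ⟨s, q, hq, hsq⟩ : ∃ s q, q.length ≤ 1 ∧ d k :: r = s ++ d k :: q := by
    rcases List.eq_nil_or_concat r with rfl | ⟨r, e, rfl⟩
    · exact ⟨[], [], by simp, rfl⟩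
    by_cases he : e = d k
    · exact ⟨d k :: r, [], by simp, by simp [he]⟩
    rcases List.eq_nil_or_concat r with rfl | ⟨r, f, rfl⟩
    · exact ⟨[], [e], by simp, by simp⟩
    have := (h.infix (u := [f, e])
      ⟨p ++ d k :: r, [], by rw [hpr]; simp⟩).eq_or_eq.resolve_right he
    exact ⟨d k :: r, [e], by simp, by simp [this]⟩
  have hs : Lang d k (s ++ [d k]) := h.infix ⟨p, q, by rw [hpr, hsq]; simp⟩
  obtain ⟨u, hu⟩ : ∃ u, s ++ [d k] = d k :: u := by
    cases s with
    | nil => exact ⟨[], rfl⟩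
    | cons c s =>
      simp only [List.cons_append, List.cons.injEq] at hsq
      exact ⟨s ++ [d k], by rw [← hsq.1]; rfl⟩
  obtain ⟨y, rfl⟩ := hs.exists_eq_map hu
  refine ⟨y, (lang_map_iff hd).1 hs, ?_, ⟨p, d k :: q, by rw [hpr, hsq]; simp⟩⟩
  have := arSubst_length_le (d k) y
  rw [hpr, hsq] at hR
  simp at hR
  omega

lemma UnifRec.infix {u v : List α} (h : UnifRec d k v) (huv : u <:+: v) : UnifRec d k u := by
  obtain ⟨R, h⟩ := h
  exact ⟨R, fun w hw hR => huv.trans (h w hw hR)⟩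

lemma UnifRec.map [Nontrivial α] (hd : Recurrent d) {x : List α} (h : UnifRec d (k + 1) x) :
    UnifRec d k (arSubst (d k) x) := by
  obtain ⟨R, h⟩ := h
  refine ⟨2 * R + 3, fun w hw hR => ?_⟩
  obtain ⟨y, hy, hyR, hyw⟩ := hw.exists_map_infix hd hR
  obtain ⟨p, q, rfl⟩ := h y hy hyR
  exact List.IsInfix.trans ⟨arSubst (d k) p, arSubst (d k) q, by simp⟩ hyw

lemma unifRec_singleton [Nontrivial α] (hd : Recurrent d) (k : ℕ) (a : α) : UnifRec d k [a] := by
  obtain ⟨n, hn, ha⟩ := hd a k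
  induction hn using Nat.decreasingInduction with
  | self =>
    refine ⟨2, fun w hw hR => ?_⟩
    rcases w with _ | ⟨c₁, _ | ⟨c₂, w⟩⟩
    · simp at hR
    · simp at hR
    · rcases (hw.infix (u := [c₁, c₂]) ⟨[], w, rfl⟩).eq_or_eq with h | h
      · exact ⟨[], c₂ :: w, by simp [h, ha]⟩
      · exact ⟨[c₁], w, by simp [h, ha]⟩
  | of_succ j hj ih =>
    obtain ⟨r, hr⟩ := exists_arSubst_concat (d j) a []
    exact (ih.map hd).infix ⟨r, [], by simpa using hr.symm⟩

lemma Lang.unifRec [Nontrivial α] (hd : Recurrent d) {u : List α} (h : Lang d k u) :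
    UnifRec d k u := by
  obtain ⟨n, a, h⟩ := h
  refine UnifRec.infix ?_ h
  clear h
  induction n generalizing k with
  | zero => exact unifRec_singleton hd k a
  | succ n ih => exact ih.map hd

end Recurrence

section Gaps

/-- Two occurrences of `v` in the language are at distance at least `R`. -/
def Gap (d : ℕ → α) (k : ℕ) (v : List α) (R : ℕ) : Prop :=
  ∀ s, s ≠ [] → Lang d k (s ++ v) → v <+: s ++ v → R ≤ s.length

lemma Gap.append {v : List α} {R : ℕ} (h : Gap d k v R) (t : List α) : Gap d k (v ++ t) R := by
  refine fun s hs hl hp => h s hs (hl.infix ⟨[], t, by simp⟩) ?_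
  exact List.prefix_of_prefix_length_le ((List.prefix_append v t).trans hp)
    ⟨t, by simp⟩ (by simp)

lemma Gap.map {v : List α} {R : ℕ} (h : Gap d (k + 1) v R) :
    Gap d k (arSubst (d k) v ++ [d k]) R := by
  rintro s hs hl ⟨r, hr⟩
  obtain ⟨x, p, q, hx, hpq⟩ := hl.exists_map
  obtain ⟨y, z, rfl, hy, hz⟩ := arSubst_split_mid (p := p ++ s) (v := v) (q := q)
    (by rw [hpq]; simp)
  obtain ⟨y', z', hyz, hy', hz'⟩ := arSubst_split_mid (p := p) (v := v) (q := r ++ q)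
    (by rw [hpq, ← hr]; simp)
  obtain ⟨s', rfl⟩ : ∃ s', s = d k :: s' := by
    obtain ⟨c, s', rfl⟩ := List.exists_cons_of_ne_nil hs
    obtain ⟨t, ht⟩ := exists_arSubst_append_singleton (d k) v
    rw [ht] at hr
    simp at hr
    exact ⟨s', by rw [hr.1]⟩
  obtain ⟨y₁, s₁, rfl, hy₁, hs₁⟩ := arSubst_split hy
  obtain rfl : y₁ = y' := arSubst_injective _ (hy₁.trans hy'.symm)
  have hs₀ : s₁ ≠ [] := by rintro rfl; simp at hs₁
  refine (h s₁ hs₀ (hx.infix ⟨y₁, z, by simp⟩) ?_).trans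
    ((length_le_arSubst (d k) s₁).trans_eq (by rw [hs₁]))
  refine List.prefix_of_prefix_length_le (l₃ := s₁ ++ v ++ z) ⟨z', ?_⟩ ⟨z, rfl⟩ (by simp)
  have : y₁ ++ (s₁ ++ v ++ z) = y₁ ++ (v ++ z') := by rw [← hyz]; simp
  exact (List.append_cancel_left this).symm

lemma Gap.singleton_succ [Nontrivial α] (hd : Recurrent d) {b : α} {R : ℕ} (hb : d k ≠ b)
    (h : Gap d (k + 1) [b] R) : Gap d k [b] (R + 1) := by
  rintro s hs hl hp
  obtain ⟨t, rfl⟩ : ∃ t, s = b :: t := by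
    obtain ⟨c, t, rfl⟩ := List.exists_cons_of_ne_nil hs
    simp at hp
    exact ⟨t, by rw [hp]⟩
  obtain ⟨e, he⟩ := hl.exists_cons hd
  obtain rfl := (he.infix (u := [e, b]) ⟨[], t ++ [b], by simp⟩).eq_or_eq.resolve_right hb.symm
  obtain ⟨f, hf⟩ := he.exists_concat hd
  obtain rfl := (hf.infix (u := [b, f]) ⟨d k :: b :: t, [], by simp⟩).eq_or_eq.resolve_left hb.symm
  obtain ⟨x, hx⟩ := hf.exists_eq_map rfl
  rw [hx, lang_map_iff hd] at hf
  obtain ⟨s', rfl⟩ := last_eq_of_arSubst_eq (q := d k :: b :: t) (c := b) (by rw [← hx]; simp)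
  obtain ⟨z, hz⟩ := head_eq_of_arSubst_eq (c := b) (q := t ++ [b]) (by rw [← hx]; simp)
  rw [arSubst_append, arSubst_cons_ne hb.symm] at hx
  cases s' with
  | nil => simpa using congrArg List.length hx
  | cons c s' =>
    obtain rfl : c = b := by simpa using congrArg List.head? hz
    have h1 := h (c :: s') (by simp) hf ⟨s' ++ [c], rfl⟩
    rw [arSubst_cons_ne hb.symm] at hx
    have h2 := congrArg List.length hx
    have h3 := length_le_arSubst (d k) s'
    simp at h1 h2 ⊢
    omega

lemma gap_singleton_of_forall_ne [Nontrivial α] (hd : Recurrent d) {b : α} {a : ℕ}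
    (h : ∀ n, k ≤ n → n < k + a → d n ≠ b) : Gap d k [b] a := by
  induction a generalizing k with
  | zero => exact fun _ _ _ _ => Nat.zero_le _
  | succ a ih =>
    exact Gap.singleton_succ hd (h k le_rfl (by omega))
      (ih fun n hn hna => h n (by omega) (by omega))

lemma exists_lang_gap [Nontrivial α] (hd : Recurrent d) {n : ℕ} {v : List α} {R : ℕ}
    (hv : Lang d (k + n) v) (h : Gap d (k + n) v R) :
    ∃ w, Lang d k w ∧ Gap d k w R ∧ w.length + 1 ≤ 2 ^ n * (v.length + 1) := by
  induction n generalizing k with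
  | zero => exact ⟨v, hv, h, by simp⟩
  | succ n ih =>
    obtain ⟨w, hw, hg, hl⟩ := ih (k := k + 1) (by rwa [add_right_comm]) (by rwa [add_right_comm])
    refine ⟨_, (lang_map_iff hd).2 hw, hg.map, ?_⟩
    have := arSubst_length_le (d k) w
    simp [pow_succ]
    nlinarith

lemma Lang.exists_append [Nontrivial α] (hd : Recurrent d) {w : List α} (hw : Lang d k w) {n : ℕ}
    (hn : w.length ≤ n) : ∃ t, Lang d k (w ++ t) ∧ (w ++ t).length = n := by
  induction n, hn using Nat.le_induction with
  | base => exact ⟨[], by simpa using hw, by simp⟩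
  | succ n _ ih =>
    obtain ⟨t, ht, hl⟩ := ih
    obtain ⟨b, hb⟩ := ht.exists_concat hd
    exact ⟨t ++ [b], by simpa using hb, by simp at hl ⊢; omega⟩

/-- If `b` does not occur in the directive sequence at `K, …, K + a - 1`, then every length
from `2 ^ (K + 1)` on carries a word of the language whose occurrences are at distance at
least `a`. -/
lemma exists_lang_gap_of_forall_ne [Nontrivial α] (hd : Recurrent d) {b : α} {K a n : ℕ}
    (h : ∀ j, K ≤ j → j < K + a → d j ≠ b) (hn : 2 ^ (K + 1) ≤ n) :
    ∃ w, Lang d 0 w ∧ Gap d 0 w a ∧ w.length = n := by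
  obtain ⟨w, hw, hg, hl⟩ := exists_lang_gap (k := 0) (n := K) hd (lang_singleton d _ b)
    (gap_singleton_of_forall_ne hd (by simpa using h))
  obtain ⟨t, ht, hlt⟩ := hw.exists_append hd (n := n) (by simp at hl; rw [pow_succ] at hn; omega)
  exact ⟨w ++ t, ht, hg.append t, hlt⟩

end Gaps

section Subshift

/-- The word of length `n` of `ω` starting at position `p`. -/
def factor (ω : ℤ → α) (p : ℤ) (n : ℕ) : List α := List.ofFn fun j : Fin n => ω (p + j)

omit [DecidableEq α] in
@[simp] lemma length_factor (ω : ℤ → α) (p : ℤ) (n : ℕ) : (factor ω p n).length = n := by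
  simp [factor]

omit [DecidableEq α] in
lemma getElem?_factor (ω : ℤ → α) (p : ℤ) {n i : ℕ} (h : i < n) :
    (factor ω p n)[i]? = some (ω (p + i)) := by
  simp [factor, h]

omit [DecidableEq α] in
lemma factor_add (ω : ℤ → α) (p : ℤ) (a b : ℕ) :
    factor ω p (a + b) = factor ω p a ++ factor ω (p + a) b := by
  simp [factor, List.ofFn_add, add_assoc]

omit [DecidableEq α] in
lemma occursAt_iff {ω : ℤ → α} {w : List α} {p : ℤ} :
    OccursAt ω w p ↔ factor ω p w.length = w := by
  constructor
  · intro h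
    refine List.ext_get (by simp) fun n h₁ h₂ => ?_
    simpa [factor] using h ⟨n, h₂⟩
  · intro h i
    have := congrArg (fun l => l[(i : ℕ)]?) h
    simpa [factor] using this

/-- The two-sided sequences all of whose factors lie in the language. -/
def langSubshift (d : ℕ → α) : Set (ℤ → α) := {ω | ∀ p n, Lang d 0 (factor ω p n)}

lemma isSubshift_langSubshift [TopologicalSpace α] [DiscreteTopology α] [Finite α] (d : ℕ → α) :
    IsSubshift (langSubshift d) := by
  constructor
  · have : langSubshift d = ⋂ (p : ℤ) (n : ℕ),
        (fun (ω : ℤ → α) (j : Fin n) => ω (p + j)) ⁻¹' {f | Lang d 0 (List.ofFn f)} := by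
      ext ω; simp [langSubshift, factor]
    rw [this]
    refine isClosed_iInter fun p => isClosed_iInter fun n => ?_
    exact (isClosed_discrete _).preimage (by fun_prop)
  · ext ω
    constructor
    · rintro ⟨η, hη, rfl⟩ p n
      have := hη (p + 1) n
      simpa [factor, shift, add_right_comm] using this
    · intro hω
      refine ⟨fun n => ω (n - 1), fun p n => ?_, by ext; simp [shift]⟩
      have := hω (p - 1) n
      simpa [factor, sub_add_eq_add_sub] using this

lemma exists_mem_langSubshift [Nontrivial α] (hd : Recurrent d) {u : List α} (hu : Lang d 0 u) :
    ∃ ω ∈ langSubshift d, OccursAt ω u 0 := by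
  have step : ∀ x : {x // Lang d 0 x}, ∃ y : {y // Lang d 0 y}, ∃ a b, y.1 = a :: (x.1 ++ [b]) := by
    rintro ⟨x, hx⟩
    obtain ⟨b, hb⟩ := hx.exists_concat hd
    obtain ⟨a, ha⟩ := hb.exists_cons hd
    exact ⟨⟨_, ha⟩, a, b, rfl⟩
  choose f hf using step
  let x : ℕ → {x // Lang d 0 x} := fun n => f^[n] ⟨u, hu⟩
  have hx : ∀ n, ∃ a b, (x (n + 1)).1 = a :: ((x n).1 ++ [b]) := fun n => by
    simp only [x, Function.iterate_succ_apply']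
    exact hf _
  have hlen : ∀ n, (x n).1.length = u.length + 2 * n := by
    intro n
    induction n with
    | zero => rfl
    | succ n ih => obtain ⟨a, b, h⟩ := hx n; simp [h, ih]; omega
  have hget : ∀ j n i, i < (x n).1.length → (x (n + j)).1[i + j]? = (x n).1[i]? := by
    intro j
    induction j with
    | zero => intros; rfl
    | succ j ih =>
      intro n i hi
      obtain ⟨a, b, h⟩ := hx (n + j)
      have := hlen (n + j)
      have := hlen n
      rw [← add_assoc, ← add_assoc, h, List.getElem?_cons_succ,
        List.getElem?_append_left (by omega),
        ih n i hi]
  let N : ℤ → ℕ := fun z => z.natAbs + 1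
  have hN : ∀ z : ℤ, (z + N z).toNat < (x (N z)).1.length := fun z => by
    have := hlen (N z); simp only [N] at *; omega
  let ω : ℤ → α := fun z => (x (N z)).1[(z + N z).toNat]'(hN z)
  have hω : ∀ (z : ℤ) (n : ℕ), 0 ≤ z + n → (z + n).toNat < (x n).1.length →
      (x n).1[(z + n).toNat]? = some (ω z) := by
    intro z n hz hn
    have h1 : (x (N z)).1[(z + N z).toNat]? = some (ω z) := List.getElem?_eq_getElem (hN z)
    have h2 : 0 ≤ z + N z := by simp only [N]; omega
    rw [← h1]
    rcases le_total n (N z) with h | h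
    · obtain ⟨j, hj⟩ := Nat.exists_eq_add_of_le h
      rw [← hget j n _ hn, hj]
      congr 1; push_cast; omega
    · obtain ⟨j, hj⟩ := Nat.exists_eq_add_of_le h
      rw [← hget j (N z) _ (hN z), hj]
      congr 1; push_cast; omega
  refine ⟨ω, fun p n => ?_, fun i => ?_⟩
  · have key : factor ω p n <:+: (x (p.natAbs + n)).1 := by
      rw [List.infix_iff_getElem?]
      refine ⟨(p + (p.natAbs + n : ℕ)).toNat, by rw [hlen, length_factor]; omega, fun i hi => ?_⟩
      rw [length_factor] at hi
      have := hω (p + i) (p.natAbs + n) (by omega) (by rw [hlen]; omega)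
      rw [(List.getElem_eq_iff _).2 (getElem?_factor ω p hi), ← this]
      congr 1
      omega
    exact (x _).2.infix key
  · have := hω i 0 (by simp) (by simp [hlen])
    simp [x] at this
    simp [← this]

lemma isWordOf_langSubshift [Nontrivial α] (hd : Recurrent d) {w : List α} :
    IsWordOf (langSubshift d) w ↔ Lang d 0 w := by
  constructor
  · rintro ⟨ω, hω, p, h⟩
    rw [← occursAt_iff.1 h]
    exact hω p _
  · intro h
    obtain ⟨ω, hω, h⟩ := exists_mem_langSubshift hd h
    exact ⟨ω, hω, 0, h⟩

lemma isMinimalSubshift_langSubshift [Nontrivial α] [TopologicalSpace α] [DiscreteTopology α]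
    [Finite α] (hd : Recurrent d) : IsMinimalSubshift (langSubshift d) := by
  refine ⟨isSubshift_langSubshift d, fun ω hω η hη => mem_closure_iff.2 fun U hU hηU => ?_⟩
  obtain ⟨I, u, hu, hIU⟩ := isOpen_pi_iff.1 hU η hηU
  obtain ⟨N, hN⟩ : ∃ N : ℕ, ∀ i ∈ I, i.natAbs ≤ N :=
    ⟨I.sup Int.natAbs, fun i hi => Finset.le_sup (f := Int.natAbs) hi⟩
  obtain ⟨R, hR⟩ := (hη (-N) (2 * N + 1)).unifRec hd
  obtain ⟨p, q, hpq⟩ := hR _ (hω 0 R) (by simp)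
  have hfac : factor ω p.length (2 * N + 1) = factor η (-N) (2 * N + 1) := by
    have hlen := congrArg List.length hpq
    simp at hlen
    have h1 : R = p.length + ((2 * N + 1) + q.length) := by omega
    rw [h1, factor_add _ _ p.length, factor_add _ _ (2 * N + 1) q.length, List.append_assoc] at hpq
    have h2 := List.append_inj_right hpq (by simp)
    simpa using (List.append_inj_left h2 (by simp)).symm
  refine ⟨fun n => ω (n + (p.length + N)), hIU fun i hi => ?_, ⟨_, rfl⟩⟩
  have hiN := hN i hi
  have h3 := congrArg (fun l => l[(i + N).toNat]?) hfac
  have h4 : (i + N).toNat < 2 * N + 1 := by omega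
  have h5 : ((i + N).toNat : ℤ) = i + N := by omega
  simp only [getElem?_factor _ _ h4, h5, Option.some.injEq] at h3
  have h6 : ω (i + (p.length + N)) = η i := by
    convert h3 using 2 <;> ring
  simpa [h6] using (hu i hi).2

lemma isArnouxRauzy_langSubshift {m : ℕ} [Nontrivial (Fin m)] {d : ℕ → Fin m}
    (hd : Recurrent d) : IsArnouxRauzy m (langSubshift d) := by
  have hR : ∀ w, (IsWordOf (langSubshift d) w ∧ RightSpecial (langSubshift d) w) ↔
      RSpecial d 0 w := fun w => by
    simp only [RightSpecial, RSpecial, isWordOf_langSubshift hd]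
    exact and_iff_right_of_imp fun ⟨a, _, _, h, _⟩ => h.infix ⟨[], [a], rfl⟩
  have hL : ∀ w, (IsWordOf (langSubshift d) w ∧ LeftSpecial (langSubshift d) w) ↔
      LSpecial d 0 w := fun w => by
    simp only [LeftSpecial, LSpecial, isWordOf_langSubshift hd]
    exact and_iff_right_of_imp fun ⟨a, _, _, h, _⟩ => h.infix ⟨[a], [], by simp⟩
  refine ⟨isMinimalSubshift_langSubshift hd, fun n => ?_, fun n => ?_, fun w hw h a => ?_,
    fun w hw h a => ?_⟩
  · simpa only [← hR, and_left_comm] using existsUnique_rSpecial hd 0 n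
  · simpa only [← hL, and_left_comm] using existsUnique_lSpecial hd 0 n
  · exact (isWordOf_langSubshift hd).2 (((hR w).1 ⟨hw, h⟩).lang_concat hd a)
  · exact (isWordOf_langSubshift hd).2 (((hL w).1 ⟨hw, h⟩).lang_cons hd a)

/-- A word whose occurrences are at distance at least `R` has frequency at most `1 / R`. -/
lemma mul_measure_Vset_le [MeasurableSpace α] [MeasurableSingletonClass α] {ν : Measure (ℤ → α)}
    [IsProbabilityMeasure ν] (hν : ν (langSubshift d)ᶜ = 0)
    (hT : MeasurePreserving (shift α) ν ν) {w : List α} {R : ℕ} (hw : Gap d 0 w R) :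
    R * (ν (Vset (langSubshift d) w)).toReal ≤ 1 := by
  set A : Set (ℤ → α) := {ω | OccursAt ω w 1} with hA
  have hAm : MeasurableSet A := by
    have : A = ⋂ i : Fin w.length, (fun ω : ℤ → α => ω (1 + i)) ⁻¹' {w.get i} := by
      ext ω; simp [hA, OccursAt]
    rw [this]
    exact MeasurableSet.iInter fun i => measurable_pi_apply _ (measurableSet_singleton _)
  have hiter : ∀ j ω n, (shift α)^[j] ω n = ω (n + j) := by
    intro j
    induction j with
    | zero => simp
    | succ j ih =>
      intro ω n
      rw [Function.iterate_succ_apply, ih]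
      simp [shift, add_assoc]
  have hfar : ∀ j j' : ℕ, j < j' → j' < R → ∀ ω ∈ langSubshift d,
      (shift α)^[j] ω ∈ A → (shift α)^[j'] ω ∈ A → False := by
    intro j j' hjj hj' ω hω h h'
    have key : ∀ l : ℕ, (shift α)^[l] ω ∈ A → factor ω (1 + l) w.length = w := fun l hl => by
      rw [← occursAt_iff]
      intro i
      have := hl i
      rw [hiter] at this
      rw [← this]
      congr 1
      ring
    obtain ⟨e, rfl⟩ := Nat.exists_eq_add_of_lt hjj
    have h1 := hω (1 + j) ((e + 1) + w.length)
    have h2 : factor ω (1 + j) ((e + 1) + w.length) = factor ω (1 + j) (e + 1) ++ w := by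
      rw [factor_add]
      congr 1
      convert key _ h' using 2
      push_cast; ring
    have h3 : factor ω (1 + j) ((e + 1) + w.length) =
        w ++ factor ω (1 + j + w.length) (e + 1) := by
      rw [add_comm (e + 1), factor_add, key _ h]
    have := hw (factor ω (1 + j) (e + 1)) (by simp [← List.length_eq_zero_iff]) (h2 ▸ h1)
      ⟨_, h3.symm.trans h2⟩
    simp at this
    omega
  have hsum : ∑ j ∈ Finset.range R, ν ((shift α)^[j] ⁻¹' A) ≤ 1 := by
    rw [← measure_biUnion_finset₀]
    · exact prob_le_one
    · intro j hj j' hj' hne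
      refine measure_mono_null (t := (langSubshift d)ᶜ) (fun ω hω hmem => ?_) hν
      simp at hj hj'
      rcases lt_or_gt_of_ne hne with h | h
      · exact hfar j j' h hj' ω hmem hω.1 hω.2
      · exact hfar j' j h hj ω hmem hω.2 hω.1
    · exact fun j _ => ((hT.iterate j).measurable hAm).nullMeasurableSet
  simp only [fun j => (hT.iterate j).measure_preimage hAm.nullMeasurableSet, Finset.sum_const,
    Finset.card_range, nsmul_eq_mul] at hsum
  have hle : (R : ENNReal) * ν (Vset (langSubshift d) w) ≤ 1 :=
    (mul_le_mul_right (measure_mono fun ω hω => hω.2) _).trans hsum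
  simpa using ENNReal.toReal_mono ENNReal.one_ne_top hle

end Subshift

end Words

section Directive

/-- The positions at which the blocks of the directive sequence start. -/
def blockStart : ℕ → ℕ
  | 0 => 0
  | k + 1 => blockStart k + 4 ^ (blockStart k + 1)

lemma blockStart_strictMono : StrictMono blockStart :=
  strictMono_nat_of_lt_succ fun k => by simp [blockStart]

/-- The index of the block containing position `j`. -/
def blockIndex (j : ℕ) : ℕ := Nat.findGreatest (fun k => blockStart k ≤ j) j

lemma le_blockIndex {k j : ℕ} (h : blockStart k ≤ j) : k ≤ blockIndex j :=
  Nat.le_findGreatest ((blockStart_strictMono.le_apply).trans h) h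

lemma blockIndex_lt {k j : ℕ} (h : j < blockStart k) : blockIndex j < k := by
  have : blockStart (blockIndex j) ≤ j :=
    Nat.findGreatest_spec (P := fun k => blockStart k ≤ j) (Nat.zero_le j) (Nat.zero_le j)
  exact blockStart_strictMono.lt_iff_lt.1 (this.trans_lt h)

variable {m : ℕ} [NeZero m]

/-- The directive sequence whose `k`-th block repeats the letter `k` modulo `m`. -/
def blockSeq (m : ℕ) [NeZero m] (j : ℕ) : Fin m := Fin.ofNat m (blockIndex j)

lemma recurrent_blockSeq : Recurrent (blockSeq m) := by
  intro a N
  have hm : 0 < m := Nat.pos_of_ne_zero (NeZero.ne m)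
  set k := a + m * N with hk
  have hNk : N ≤ k := by nlinarith
  refine ⟨blockStart k, hNk.trans blockStart_strictMono.le_apply, ?_⟩
  have h1 := le_blockIndex (le_refl (blockStart k))
  have h2 := blockIndex_lt (blockStart_strictMono (Nat.lt_succ_self k))
  have h3 : blockIndex (blockStart k) = k := by omega
  ext
  change blockIndex (blockStart k) % m = a
  rw [h3, hk, Nat.add_mul_mod_self_left, Nat.mod_eq_of_lt a.2]

lemma blockSeq_ne (hm : 3 ≤ m) {k j : ℕ} (h : blockStart (k + 1) ≤ j)
    (h' : j < blockStart (k + 3)) : blockSeq m j ≠ Fin.ofNat m k := by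
  intro he
  have h1 := le_blockIndex h
  have h2 := blockIndex_lt h'
  have h3 : k ≡ blockIndex j [MOD m] := by
    simpa [blockSeq, Nat.ModEq] using (congrArg Fin.val he).symm
  have := Nat.le_of_dvd (by omega) ((Nat.modEq_iff_dvd' (by omega)).1 h3)
  omega

lemma exists_blockSeq_ne (hm : 3 ≤ m) {C : ℝ} (hC : 0 < C) :
    ∃ N : ℕ, ∀ n : ℕ, N ≤ n → ∃ (K a : ℕ) (b : Fin m), 2 ^ (K + 1) ≤ n ∧ (n : ℝ) < C * a ∧
      ∀ j, K ≤ j → j < K + a → blockSeq m j ≠ b := by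
  obtain ⟨k₀, hk₀⟩ := exists_nat_gt (1 / C)
  refine ⟨2 ^ (blockStart (k₀ + 1) + 1), fun n hn => ?_⟩
  obtain ⟨k, hk, hkn, hnk⟩ : ∃ k, k₀ ≤ k ∧ 2 ^ (blockStart (k + 1) + 1) ≤ n ∧
      n < 2 ^ (blockStart (k + 2) + 1) := by
    by_contra! H
    have : ∀ k, k₀ ≤ k → 2 ^ (blockStart (k + 1) + 1) ≤ n := fun k hk => by
      induction k, hk using Nat.le_induction with
      | base => exact hn
      | succ k hk ih => exact H k hk ih
    have h1 := this (n + k₀) (by omega)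
    have h2 : n + k₀ + 1 ≤ blockStart (n + k₀ + 1) := blockStart_strictMono.le_apply
    have h3 := Nat.lt_two_pow_self (n := blockStart (n + k₀ + 1) + 1)
    omega
  refine ⟨blockStart (k + 1), blockStart (k + 3) - blockStart (k + 1), Fin.ofNat m k, hkn, ?_,
    fun j hj hj' => blockSeq_ne hm hj (by omega)⟩
  set M : ℕ := 2 ^ (blockStart (k + 2) + 1) with hM
  have h1 : M * M ≤ blockStart (k + 3) - blockStart (k + 1) := by
    have h2 : blockStart (k + 3) = blockStart (k + 2) + 4 ^ (blockStart (k + 2) + 1) := rfl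
    have h3 : blockStart (k + 1) < blockStart (k + 2) := blockStart_strictMono (by omega)
    have h4 : M * M = 4 ^ (blockStart (k + 2) + 1) := by rw [hM, ← mul_pow]; norm_num
    rw [← h4] at h2
    omega
  have h2 : k₀ < M := by
    have h3 : k + 2 ≤ blockStart (k + 2) := blockStart_strictMono.le_apply
    have h4 := Nat.lt_two_pow_self (n := blockStart (k + 2) + 1)
    omega
  have h3 : 1 < C * M := by
    rw [div_lt_iff₀ hC] at hk₀
    have : (k₀ : ℝ) < M := by exact_mod_cast h2
    nlinarith
  calc (n : ℝ) < M := by exact_mod_cast hnk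
    _ ≤ C * M * M := le_mul_of_one_le_left (Nat.cast_nonneg _) h3.le
    _ ≤ C * (blockStart (k + 3) - blockStart (k + 1) : ℕ) := by
      rw [mul_assoc]
      gcongr
      exact_mod_cast h1

lemma not_condB_langSubshift [Nontrivial (Fin m)] (hm : 3 ≤ m) :
    ¬ CondB (langSubshift (blockSeq m)) := by
  rintro ⟨ν, hprob, hν, hT, C, hC, l, hl, h⟩
  obtain ⟨N, hN⟩ := exists_blockSeq_ne hm hC
  obtain ⟨n, hn⟩ := (hl.eventually_ge_atTop N).exists
  obtain ⟨K, a, b, hK, ha, hb⟩ := hN _ hn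
  obtain ⟨w, hw, hg, hlen⟩ := exists_lang_gap_of_forall_ne recurrent_blockSeq hb hK
  have h1 := h n w ((isWordOf_langSubshift recurrent_blockSeq).2 hw) hlen
  have h2 := mul_measure_Vset_le hν hT.toMeasurePreserving hg
  rw [hlen] at h1
  have h3 : 0 ≤ (ν (Vset (langSubshift (blockSeq m)) w)).toReal := ENNReal.toReal_nonneg
  rcases h3.eq_or_lt with h4 | h4
  · rw [← h4] at h1
    linarith
  · nlinarith [mul_lt_mul_of_pos_right ha h4]

end Directive

end ArnouxRauzy

/-- for every `m ≥ 3` there is an Arnoux-Rauzy subshift over `m` symbols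
that fails Boshernitzan's condition (B). -/
theorem stmt18 (m : ℕ) (hm : 3 ≤ m) :
    ∃ Ω : Set (ℤ → Fin m), IsArnouxRauzy m Ω ∧ ¬ CondB Ω := by
  have : NeZero m := ⟨by omega⟩
  have : Nontrivial (Fin m) := Fin.nontrivial_iff_two_le.2 (by omega)
  exact ⟨ArnouxRauzy.langSubshift (ArnouxRauzy.blockSeq m),
    ArnouxRauzy.isArnouxRauzy_langSubshift ArnouxRauzy.recurrent_blockSeq,
    ArnouxRauzy.not_condB_langSubshift hm⟩
end
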